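/- arXiv:1905.09631 — 2 statements merged into one kernel-verified Lean document; each statement's English description precedes it below -/
import Mathlib

section
/- Suppose (H₁H₂/(H₁+H₂))·(2|k|+d) < 1. Then for every T>0 and every even integer m≥2 there is a constant C>0 (depending on T, m, d, k, H₁, H₂ but not on ε or x) such that E[|L_ε^{(k)}(T,x)|^m] ≤ C for all ε>0 and all x∈ℝ^d. -/
open MeasureTheory ProbabilityTheory Filter Topology

noncomputable section

/-- The Gaussian heat kernel on `ℝ^d` with variance parameter `ε`. -/
def heatKernel (d : ℕ) (ε : ℝ) (x : Fin d → ℝ) : ℝ :=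
  (2 * Real.pi * ε) ^ (-(d : ℝ) / 2) * Real.exp (-(∑ i, (x i) ^ 2) / (2 * ε))

/-- Partial derivative in the `i`-th coordinate direction. -/
def pderivCoord (d : ℕ) (i : Fin d) (f : (Fin d → ℝ) → ℝ) : (Fin d → ℝ) → ℝ :=
  fun x => fderiv ℝ f x (Pi.single i 1)

/-- Iterated partial derivative `∂^{|k|}/∂x₁^{k₁}⋯∂x_d^{k_d}`. -/
def multiPDeriv (d : ℕ) (k : Fin d → ℕ) (f : (Fin d → ℝ) → ℝ) : (Fin d → ℝ) → ℝ :=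
  (List.finRange d).foldr (fun i g => (pderivCoord d i)^[k i] g) f

/-- `p_ε^{(k)}`, the `k`-th partial derivative of the Gaussian heat kernel. -/
def heatKernelDeriv (d : ℕ) (k : Fin d → ℕ) (ε : ℝ) : (Fin d → ℝ) → ℝ :=
  multiPDeriv d k (heatKernel d ε)

/-- The approximate `k`-th derivative of the local time,
`L_ε^{(k)}(T,x) = ∫₀^T ∫₀^T p_ε^{(k)}(X_t − X̃_s − x) ds dt`. -/
def locTimeApprox (d : ℕ) {Ω : Type*} (X Xt : ℝ → Ω → Fin d → ℝ)
    (k : Fin d → ℕ) (ε T : ℝ) (x : Fin d → ℝ) (ω : Ω) : ℝ :=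
  ∫ t in Set.Icc (0 : ℝ) T, ∫ s in Set.Icc (0 : ℝ) T,
    heatKernelDeriv d k ε (fun i => X t ω i - Xt s ω i - x i)

open scoped ENNReal

/-- **Tonelli's theorem** for products of functions of finitely many separate variables. -/
theorem lintegral_fin_prod_eq_prod {E : Type*} [MeasureSpace E]
    [SigmaFinite (volume : Measure E)] :
    ∀ (n : ℕ) (f : Fin n → E → ℝ≥0∞), (∀ i, Measurable (f i)) →
      ∫⁻ x : Fin n → E, ∏ i, f i (x i) = ∏ i, ∫⁻ y, f i y
  | 0, f, _ => by simp [volume_pi]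
  | n + 1, f, hf => by
    have h := (volume_preserving_piFinSuccAbove (fun _ : Fin (n + 1) => E) 0).symm
    rw [← h.lintegral_comp_emb (MeasurableEquiv.measurableEmbedding _), Fin.prod_univ_succ,
      ← lintegral_fin_prod_eq_prod n (fun i => f i.succ) (fun i => hf _), Measure.volume_eq_prod]
    refine Eq.trans ?_ (lintegral_prod_mul (hf 0).aemeasurable
      (Finset.measurable_prod _ fun i _ =>
        (hf (Fin.succ i)).comp (measurable_pi_apply i)).aemeasurable)
    refine lintegral_congr fun z => ?_
    rw [Fin.prod_univ_succ]
    rfl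

theorem lintegral_comp_linearEquiv {E : Type*} [NormedAddCommGroup E] [NormedSpace ℝ E]
    [MeasurableSpace E] [BorelSpace E] [FiniteDimensional ℝ E] (μ : Measure E)
    [μ.IsAddHaarMeasure] (L : E ≃ₗ[ℝ] E) {g : E → ℝ≥0∞} (hg : Measurable g) :
    ∫⁻ x, g (L x) ∂μ
      = ENNReal.ofReal |(LinearMap.det (L : E →ₗ[ℝ] E))⁻¹| * ∫⁻ x, g x ∂μ := by
  have hL : LinearMap.det (L : E →ₗ[ℝ] E) ≠ 0 := (LinearEquiv.isUnit_det' L).ne_zero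
  have h := Measure.map_linearMap_addHaar_eq_smul_addHaar μ hL
  have hm : Measurable (L : E →ₗ[ℝ] E) := (LinearMap.continuous_of_finiteDimensional _).measurable
  rw [← smul_eq_mul, ← lintegral_smul_measure, ← h, lintegral_map hg hm]
  rfl

theorem lintegral_rpow_mul_exp_neg_mul_sq_lt_top {a R : ℝ} (ha : 0 < a) (b : ℝ) (hR : 1 ≤ R) :
    ∫⁻ z : ℝ, ENNReal.ofReal ((R + |z|) ^ b * Real.exp (-a * z ^ 2)) < ∞ := by
  obtain ⟨n, hn⟩ := exists_nat_ge b
  have hbd : ∀ z : ℝ, (R + |z|) ^ b * Real.exp (-a * z ^ 2)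
      ≤ (n.factorial * Real.exp (R + 1 / (2 * a))) * Real.exp (-(a / 2) * z ^ 2) := by
    intro z
    have h1 : (R + |z|) ^ b ≤ (R + |z|) ^ n := by
      rw [← Real.rpow_natCast]
      exact Real.rpow_le_rpow_of_exponent_le (by linarith [abs_nonneg z]) hn
    have h2 : (R + |z|) ^ n ≤ n.factorial * Real.exp (R + |z|) := by
      have := Real.pow_div_factorial_le_exp (R + |z|) (by positivity) n
      rwa [div_le_iff₀' (by positivity)] at this
    have h3 : |z| ≤ 1 / (2 * a) + a / 2 * z ^ 2 := by
      rw [← sq_abs z, ← sub_nonneg]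
      have : 1 / (2 * a) + a / 2 * |z| ^ 2 - |z| = (1 - a * |z|) ^ 2 / (2 * a) := by
        field_simp; ring
      rw [this]; positivity
    calc _ ≤ n.factorial * Real.exp (R + |z|) * Real.exp (-a * z ^ 2) := by
          gcongr; exact h1.trans h2
      _ = n.factorial * Real.exp (R + |z| + -a * z ^ 2) := by rw [Real.exp_add _ (-a * z ^ 2)]; ring
      _ ≤ n.factorial * Real.exp ((R + 1 / (2 * a)) + -(a / 2) * z ^ 2) :=
          mul_le_mul_of_nonneg_left (Real.exp_le_exp.2 (by linarith)) (by positivity)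
      _ = _ := by rw [Real.exp_add _ (-(a / 2) * z ^ 2)]; ring
  refine (lintegral_mono fun z => ENNReal.ofReal_le_ofReal (hbd z)).trans_lt ?_
  have h_int : Integrable fun z : ℝ => (n.factorial * Real.exp (R + 1 / (2 * a)))
      * Real.exp (-(a / 2) * z ^ 2) :=
    (integrable_exp_neg_mul_sq (half_pos ha)).const_mul _
  exact (hasFiniteIntegral_iff_ofReal (ae_of_all _ fun z => by positivity)).1 h_int.2

theorem exists_lintegral_scaled_gaussian_le {a R b : ℝ} (ha : 0 < a) (hb : 0 ≤ b) :
    ∃ K : ℝ, 0 ≤ K ∧ ∀ r : ℝ, 0 < r → r ≤ R →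
      ∫⁻ x : ℝ, ENNReal.ofReal ((1 + |x|) ^ b * Real.exp (-a * (r * x) ^ 2))
        ≤ ENNReal.ofReal (K * r ^ (-(1 + b))) := by
  set g : ℝ → ℝ≥0∞ := fun z => ENNReal.ofReal ((max 1 R + |z|) ^ b * Real.exp (-a * z ^ 2))
    with hg
  have hfin := lintegral_rpow_mul_exp_neg_mul_sq_lt_top ha b (le_max_left 1 R)
  have hgm : Measurable g := by fun_prop
  refine ⟨(∫⁻ z, g z).toReal, ENNReal.toReal_nonneg, fun r hr hrR => ?_⟩
  have hpt : ∀ x : ℝ, ENNReal.ofReal ((1 + |x|) ^ b * Real.exp (-a * (r * x) ^ 2))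
      ≤ ENNReal.ofReal (r ^ (-b)) * g (r * x) := by
    intro x
    rw [hg, ← ENNReal.ofReal_mul (by positivity), ← mul_assoc]
    refine ENNReal.ofReal_le_ofReal (mul_le_mul_of_nonneg_right ?_ (Real.exp_nonneg _))
    have : 1 + |x| = r⁻¹ * (r + |r * x|) := by
      rw [abs_mul, abs_of_pos hr]; field_simp
    rw [this, Real.mul_rpow (by positivity) (by positivity), Real.inv_rpow hr.le,
      ← Real.rpow_neg hr.le]
    gcongr
    exact hrR.trans (le_max_right _ _)
  have hscale : ∫⁻ x, g (r * x) = ENNReal.ofReal r⁻¹ * ∫⁻ z, g z := by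
    rw [← lintegral_map hgm (measurable_const_mul r), Real.map_volume_mul_left hr.ne',
      lintegral_smul_measure, abs_of_pos (inv_pos.2 hr), smul_eq_mul]
  calc _ ≤ ∫⁻ x, ENNReal.ofReal (r ^ (-b)) * g (r * x) := lintegral_mono hpt
    _ = ENNReal.ofReal (r ^ (-b)) * (ENNReal.ofReal r⁻¹ * ENNReal.ofReal (∫⁻ z, g z).toReal) := by
        rw [lintegral_const_mul _ (by fun_prop), hscale, ENNReal.ofReal_toReal hfin.ne]
    _ = _ := by
        rw [← ENNReal.ofReal_mul (by positivity), ← ENNReal.ofReal_mul (by positivity), neg_add,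
          Real.rpow_add hr, Real.rpow_neg_one]
        congr 1; ring

/-- The sums `∑_{l ≥ j} y_l`. -/
def suffixSum (M : ℕ) (V : Type*) [AddCommGroup V] [Module ℝ V] :
    (Fin M → V) →ₗ[ℝ] (Fin M → V) where
  toFun y j := ∑ l ∈ Finset.Ici j, y l
  map_add' y z := by ext j; simp [Finset.sum_add_distrib]
  map_smul' a y := by ext j; simp [Finset.smul_sum]

theorem suffixSum_apply {M : ℕ} {V : Type*} [AddCommGroup V] [Module ℝ V] (y : Fin M → V)
    (j : Fin M) : suffixSum M V y j = ∑ l ∈ Finset.Ici j, y l := rfl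

theorem suffixSum_injective (M : ℕ) (V : Type*) [AddCommGroup V] [Module ℝ V] :
    Function.Injective (suffixSum M V) := by
  rw [← LinearMap.ker_eq_bot, LinearMap.ker_eq_bot']
  intro y hy
  ext j
  induction j using WellFoundedGT.induction with
  | ind j ih =>
    have h : ∑ l ∈ Finset.Ici j, y l = 0 := congrFun hy j
    rwa [← Finset.Ioi_insert, Finset.sum_insert (by simp),
      Finset.sum_eq_zero (fun l hl => ih l (by simpa using hl)), add_zero] at h

/-- The sequence `0, s₁, …, s_M, 0, 0, …`. -/
def gridSeq {M : ℕ} (s : Fin M → ℝ) : ℕ → ℝ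
  | 0 => 0
  | j + 1 => if h : j < M then s ⟨j, h⟩ else 0

@[simp] theorem gridSeq_zero {M : ℕ} (s : Fin M → ℝ) : gridSeq s 0 = 0 := rfl

@[simp] theorem gridSeq_succ {M : ℕ} (s : Fin M → ℝ) (j : Fin M) :
    gridSeq s ((j : ℕ) + 1) = s j := by
  simp [gridSeq]

/-- The increments `s_j - s_{j-1}`, with `s₀ = 0`. -/
def gridDiff (M : ℕ) : (Fin M → ℝ) →ₗ[ℝ] (Fin M → ℝ) where
  toFun s j := gridSeq s ((j : ℕ) + 1) - gridSeq s j
  map_add' s t := by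
    have h : ∀ n, gridSeq (s + t) n = gridSeq s n + gridSeq t n := by
      rintro (_ | n)
      · simp
      · by_cases hn : n < M <;> simp [gridSeq, hn]
    ext j
    simp only [h, Pi.add_apply]
    ring
  map_smul' a s := by
    have h : ∀ n, gridSeq (a • s) n = a * gridSeq s n := by
      rintro (_ | n)
      · simp
      · by_cases hn : n < M <;> simp [gridSeq, hn]
    ext j
    simp only [h, Pi.smul_apply, smul_eq_mul, RingHom.id_apply]
    ring

theorem gridDiff_apply {M : ℕ} (s : Fin M → ℝ) (j : Fin M) :
    gridDiff M s j = gridSeq s ((j : ℕ) + 1) - gridSeq s j := rfl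

theorem gridDiff_injective (M : ℕ) : Function.Injective (gridDiff M) := by
  rw [← LinearMap.ker_eq_bot, LinearMap.ker_eq_bot']
  intro s hs
  have h : ∀ n ≤ M, gridSeq s n = 0 := by
    intro n
    induction n with
    | zero => simp
    | succ n ih =>
      intro hn
      have h1 := congrFun hs ⟨n, hn⟩
      rw [gridDiff_apply] at h1
      simpa [ih (by omega)] using h1
  ext j
  simpa using h ((j : ℕ) + 1) j.2

/-- Abel summation against the increments of a function along a grid. -/
theorem sum_suffixSum_mul_increment {M : ℕ} (y s : Fin M → ℝ) (f : ℝ → ℝ) :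
    ∑ j : Fin M, suffixSum M ℝ y j * (f (gridSeq s ((j : ℕ) + 1)) - f (gridSeq s j))
      = ∑ j, y j * f (s j) - (∑ j, y j) * f 0 := by
  have htel : ∀ l : Fin M, ∑ j : Fin M,
      (if j ≤ l then f (gridSeq s ((j : ℕ) + 1)) - f (gridSeq s j) else 0) = f (s l) - f 0 := by
    intro l
    have h1 := Fin.sum_univ_eq_sum_range
      (fun n => if n ≤ (l : ℕ) then f (gridSeq s (n + 1)) - f (gridSeq s n) else 0) M
    have h2 : (Finset.range M).filter (fun n => n ≤ (l : ℕ)) = Finset.range ((l : ℕ) + 1) := by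
      ext n; simp only [Finset.mem_filter, Finset.mem_range]; omega
    rw [← Finset.sum_filter (s := Finset.range M), h2,
      Finset.sum_range_sub (fun n => f (gridSeq s n))] at h1
    simpa using h1
  have h : ∀ j : Fin M, suffixSum M ℝ y j = ∑ l, if j ≤ l then y l else 0 := by
    intro j
    rw [suffixSum_apply, ← Finset.sum_filter]
    congr 1; ext l; simp
  simp_rw [h, Finset.sum_mul]
  rw [Finset.sum_comm, ← Finset.sum_sub_distrib]
  refine Finset.sum_congr rfl fun l _ => ?_
  rw [← mul_sub, ← htel, Finset.mul_sum]
  refine Finset.sum_congr rfl fun j _ => ?_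
  split_ifs <;> simp

theorem prod_one_add_abs_le {M : ℕ} (y : Fin M → ℝ) :
    ∏ j, (1 + |y j|) ≤ (∏ j, (1 + |suffixSum M ℝ y j|)) ^ 2 := by
  set x : ℕ → ℝ := fun n => ∑ l : Fin M, if n ≤ (l : ℕ) then y l else 0 with hx
  have hS : ∀ j : Fin M, suffixSum M ℝ y j = x j := by
    intro j
    simp only [suffixSum_apply, hx]
    rw [← Finset.sum_filter]
    congr 1; ext l; simp
  have hxM : x M = 0 := by
    rw [hx]; exact Finset.sum_eq_zero fun l _ => if_neg (by omega)
  have hy : ∀ j : Fin M, y j = x j - x ((j : ℕ) + 1) := by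
    intro j
    rw [hx, ← Finset.sum_sub_distrib, Finset.sum_eq_single j]
    · simp
    · intro l _ hl
      have : (l : ℕ) ≠ j := fun h => hl (Fin.ext h)
      by_cases h : (j : ℕ) ≤ l
      · rw [if_pos h, if_pos (by omega), sub_self]
      · rw [if_neg h, if_neg (by omega), sub_self]
    · simp
  have hshift : ∏ n ∈ Finset.range M, (1 + |x (n + 1)|) ≤ ∏ n ∈ Finset.range M, (1 + |x n|) := by
    have h1 := Finset.prod_range_succ (fun n => 1 + |x n|) M
    rw [Finset.prod_range_succ', hxM, abs_zero, add_zero, mul_one] at h1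
    rw [← h1]
    exact le_mul_of_one_le_right (Finset.prod_nonneg fun _ _ => by positivity)
      (by linarith [abs_nonneg (x 0)])
  simp_rw [hS]
  rw [Fin.prod_univ_eq_prod_range (fun n => 1 + |x n|) M, sq]
  calc ∏ j, (1 + |y j|) ≤ ∏ j : Fin M, (1 + |x j|) * (1 + |x ((j : ℕ) + 1)|) := by
        refine Finset.prod_le_prod (fun _ _ => by positivity) fun j _ => ?_
        rw [hy]
        have := abs_sub (x j) (x ((j : ℕ) + 1))
        nlinarith [abs_nonneg (x j), abs_nonneg (x ((j : ℕ) + 1)),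
          mul_nonneg (abs_nonneg (x j)) (abs_nonneg (x ((j : ℕ) + 1)))]
    _ = (∏ n ∈ Finset.range M, (1 + |x n|)) * ∏ n ∈ Finset.range M, (1 + |x (n + 1)|) := by
        rw [Finset.prod_mul_distrib, Fin.prod_univ_eq_prod_range (fun n => 1 + |x n|) M,
          Fin.prod_univ_eq_prod_range (fun n => 1 + |x (n + 1)|) M]
    _ ≤ _ := mul_le_mul_of_nonneg_left hshift (Finset.prod_nonneg fun _ _ => by positivity)

/-- The weight `∏ᵢ (1 + |yᵢ|)^{κᵢ}`. -/
def polyWeight {d : ℕ} (κ y : Fin d → ℝ) : ℝ := ∏ i, (1 + |y i|) ^ κ i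

/-- The lower bound on the variance of `∑ⱼ yⱼ · (X_{sⱼ} - X₀)` given by local nondeterminism,
expressed through the increments of the increasing rearrangement of `s`. -/
def sortedEnergy {M d : ℕ} (c H : ℝ) (s : Fin M → ℝ) (y : Fin M → Fin d → ℝ) : ℝ :=
  c * ∑ i, ∑ j, (suffixSum M ℝ (fun l => y (Tuple.sort s l) i) j) ^ 2
    * (gridDiff M (s ∘ Tuple.sort s) j) ^ (2 * H)

theorem exists_lintegral_sortedEnergy_le {M d : ℕ} {H p c T : ℝ} (hH : 0 < H) (hp : 0 < p)
    (hc : 0 < c) (hT : 0 < T) {κ : Fin d → ℝ} (hκ : ∀ i, 0 ≤ κ i)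
    (hlt : H / p * (2 * ∑ i, κ i + d) < 1) :
    ∃ Ψ : (Fin M → ℝ) → ℝ≥0∞, Measurable Ψ ∧ ∫⁻ s, Ψ s < ∞ ∧
      ∀ s : Fin M → ℝ, Function.Injective s → (∀ j, s j ∈ Set.Ioc 0 T) →
        (∫⁻ y : Fin M → Fin d → ℝ, ENNReal.ofReal ((∏ j, polyWeight κ (y j))
          * Real.exp (-(p / 2) * sortedEnergy c H s y))) ^ (1 / p) ≤ Ψ s := by
  choose K hK0 hK using fun i => exists_lintegral_scaled_gaussian_le (a := p / 2 * c)
    (R := T ^ H) (b := 2 * κ i) (by positivity) (mul_nonneg zero_le_two (hκ i))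
  set α : ℝ := H / p * (2 * ∑ i, κ i + d) with hα
  set B : ℝ := ∏ i, K i with hB
  have hB0 : 0 ≤ B := Finset.prod_nonneg fun i _ => hK0 i
  have hperm : ∀ σ : Equiv.Perm (Fin M), ∃ A : ℝ≥0∞, A ≠ ∞ ∧
      ∀ g : (Fin M → Fin d → ℝ) → ℝ≥0∞, Measurable g →
        ∫⁻ y, g (suffixSum M (Fin d → ℝ) (y ∘ σ)) = A * ∫⁻ y, g y := by
    intro σ
    set L := LinearEquiv.ofInjectiveEndo
      ((suffixSum M (Fin d → ℝ)).comp (LinearMap.funLeft ℝ (Fin d → ℝ) σ))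
      ((suffixSum_injective M _).comp (
        LinearMap.funLeft_injective_of_surjective _ _ _ σ.surjective))
      with hL
    exact ⟨_, ENNReal.ofReal_ne_top, fun g hg => lintegral_comp_linearEquiv volume L hg⟩
  have hperm' : ∀ σ : Equiv.Perm (Fin M), ∃ A : ℝ≥0∞, A ≠ ∞ ∧
      ∀ g : (Fin M → ℝ) → ℝ≥0∞, Measurable g →
        ∫⁻ y, g (gridDiff M (y ∘ σ)) = A * ∫⁻ y, g y := by
    intro σ
    set L := LinearEquiv.ofInjectiveEndo ((gridDiff M).comp (LinearMap.funLeft ℝ ℝ σ))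
      ((gridDiff_injective M).comp (
        LinearMap.funLeft_injective_of_surjective _ _ _ σ.surjective))
      with hL
    exact ⟨_, ENNReal.ofReal_ne_top, fun g hg => lintegral_comp_linearEquiv volume L hg⟩
  choose A hA hAg using hperm
  choose A' hA' hAg' using hperm'
  set ψ : ℝ → ℝ≥0∞ :=
    (Set.Ioc 0 T).indicator fun τ => ENNReal.ofReal (B ^ (1 / p) * τ ^ (-α)) with hψ
  have hψm : Measurable ψ := Measurable.indicator (by fun_prop) measurableSet_Ioc
  have hψfin : ∫⁻ τ, ψ τ < ∞ := by
    rw [hψ, lintegral_indicator measurableSet_Ioc]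
    have h1 : IntervalIntegrable (fun τ : ℝ => τ ^ (-α)) volume 0 T :=
      intervalIntegral.intervalIntegrable_rpow' (by linarith)
    have h2 := ((intervalIntegrable_iff_integrableOn_Ioc_of_le hT.le).1 h1).const_mul (B ^ (1 / p))
    refine (hasFiniteIntegral_iff_ofReal ?_).1 h2.2
    filter_upwards [ae_restrict_mem measurableSet_Ioc] with τ hτ
    have := hτ.1
    simp only [Pi.zero_apply]
    positivity
  have hprodm : Measurable fun τ : Fin M → ℝ => ∏ j, ψ (τ j) :=
    Finset.measurable_prod _ fun j _ => hψm.comp (measurable_pi_apply j)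
  have hdm : ∀ σ : Equiv.Perm (Fin M), Measurable fun s : Fin M → ℝ => gridDiff M (s ∘ σ) :=
    fun σ => (LinearMap.continuous_of_finiteDimensional _).measurable.comp
      (measurable_pi_lambda _ fun j => measurable_pi_apply _)
  have hcm : ∀ σ : Equiv.Perm (Fin M),
      Measurable fun s : Fin M → ℝ => ∏ j, ψ (gridDiff M (s ∘ σ) j) :=
    fun σ => hprodm.comp (hdm σ)
  refine ⟨fun s => ∑ σ, A σ ^ (1 / p) * ∏ j, ψ (gridDiff M (s ∘ σ) j), ?_, ?_, ?_⟩
  · exact Finset.measurable_sum _ fun σ _ => (hcm σ).const_mul _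
  · rw [lintegral_finsetSum _ fun σ _ => (hcm σ).const_mul _]
    refine ENNReal.sum_lt_top.2 fun σ _ => ?_
    rw [lintegral_const_mul _ (hcm σ), hAg' σ _ hprodm,
      lintegral_fin_prod_eq_prod M (fun _ => ψ) fun _ => hψm]
    exact ENNReal.mul_lt_top (ENNReal.rpow_lt_top_of_nonneg (by positivity) (hA σ))
      (ENNReal.mul_lt_top (hA' σ).lt_top (ENNReal.prod_lt_top fun _ _ => hψfin))
  · intro s hs hsT
    set σ := Tuple.sort s with hσ
    have hstrict : StrictMono (s ∘ σ) :=
      (Tuple.monotone_sort s).strictMono_of_injective (hs.comp σ.injective)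
    set τ := gridDiff M (s ∘ σ) with hτ
    have hτmem : ∀ j, τ j ∈ Set.Ioc 0 T := by
      intro j
      rw [hτ, gridDiff_apply, gridSeq_succ]
      have h1 : ∀ n : ℕ, n < j + 1 → gridSeq (s ∘ σ) n < (s ∘ σ) j ∧ 0 ≤ gridSeq (s ∘ σ) n := by
        rintro (_ | n) hn
        · simpa using (hsT (σ j)).1
        · have hnM : n < M := by omega
          have hlt : (⟨n, hnM⟩ : Fin M) < j := Fin.lt_def.2 (by simpa using hn)
          simp only [gridSeq, hnM, dif_pos]
          exact ⟨hstrict hlt, (hsT _).1.le⟩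
      obtain ⟨h2, h3⟩ := h1 j (by omega)
      exact ⟨sub_pos.2 h2, by have := (hsT (σ j)).2; simp only [Function.comp] at *; linarith⟩
    set φ : Fin M → Fin d → ℝ → ℝ≥0∞ := fun j i x =>
      ENNReal.ofReal ((1 + |x|) ^ (2 * κ i) * Real.exp (-(p / 2 * c) * (τ j ^ H * x) ^ 2)) with hφ
    have hφm : ∀ j i, Measurable (φ j i) := fun j i => by fun_prop
    have hpt : ∀ y : Fin M → Fin d → ℝ, ENNReal.ofReal ((∏ j, polyWeight κ (y j))
          * Real.exp (-(p / 2) * sortedEnergy c H s y))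
        ≤ ∏ j, ∏ i, φ j i (suffixSum M (Fin d → ℝ) (y ∘ σ) j i) := by
      intro y
      have hx : ∀ j i, suffixSum M (Fin d → ℝ) (y ∘ σ) j i
          = suffixSum M ℝ (fun l => y (σ l) i) j := by
        intro j i; simp [suffixSum_apply, Finset.sum_apply]
      simp_rw [hφ, hx]
      simp_rw [← ENNReal.ofReal_prod_of_nonneg (fun i _ => mul_nonneg (Real.rpow_nonneg
        (add_nonneg zero_le_one (abs_nonneg _)) _) (Real.exp_nonneg _))]
      rw [← ENNReal.ofReal_prod_of_nonneg (fun j _ => Finset.prod_nonneg fun i _ =>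
        mul_nonneg (Real.rpow_nonneg (add_nonneg zero_le_one (abs_nonneg _)) _)
          (Real.exp_nonneg _))]
      refine ENNReal.ofReal_le_ofReal ?_
      simp_rw [Finset.prod_mul_distrib, ← Real.exp_sum]
      refine mul_le_mul ?_ (le_of_eq ?_) (Real.exp_nonneg _) (Finset.prod_nonneg fun j _ =>
        Finset.prod_nonneg fun i _ => by positivity)
      · simp only [polyWeight]
        rw [Finset.prod_comm, Finset.prod_comm (s := Finset.univ) (t := Finset.univ)
          (f := fun j i => (1 + |suffixSum M ℝ (fun l => y (σ l) i) j|) ^ (2 * κ i))]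
        refine Finset.prod_le_prod (fun i _ => Finset.prod_nonneg fun j _ => by positivity)
          fun i _ => ?_
        rw [Real.finsetProd_rpow _ _ (fun j _ => by positivity),
          Real.finsetProd_rpow _ _ (fun j _ => by positivity),
          Real.rpow_mul (Finset.prod_nonneg fun j _ => by positivity),
          ← Equiv.prod_comp σ (fun j => 1 + |y j i|)]
        refine Real.rpow_le_rpow (Finset.prod_nonneg fun j _ => by positivity) ?_ (hκ i)
        rw [Real.rpow_two]
        exact prod_one_add_abs_le fun l => y (σ l) i
      · congr 1
        rw [sortedEnergy, Finset.sum_comm, ← mul_assoc, Finset.mul_sum]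
        refine Finset.sum_congr rfl fun j _ => ?_
        rw [Finset.mul_sum]
        refine Finset.sum_congr rfl fun i _ => ?_
        rw [mul_pow, ← Real.rpow_mul_natCast (hτmem j).1.le, ← hσ, ← hτ, mul_comm 2 H]
        push_cast
        ring
    have h_int : ∫⁻ y : Fin M → Fin d → ℝ, ∏ j, ∏ i, φ j i (y j i)
        ≤ ∏ j, ENNReal.ofReal (B * τ j ^ (-(α * p))) := by
      rw [lintegral_fin_prod_eq_prod M (fun j (v : Fin d → ℝ) => ∏ i, φ j i (v i))
        fun j => by fun_prop]
      refine Finset.prod_le_prod' fun j _ => ?_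
      rw [lintegral_fin_prod_eq_prod d (φ j) (hφm j)]
      have hτ0 := (hτmem j).1
      have hr : 0 < τ j ^ H := by positivity
      refine (Finset.prod_le_prod' fun i _ => hK i (τ j ^ H) hr
        (Real.rpow_le_rpow hτ0.le (hτmem j).2 hH.le)).trans (le_of_eq ?_)
      rw [← ENNReal.ofReal_prod_of_nonneg (fun i _ => mul_nonneg (hK0 i) (by positivity)),
        Finset.prod_mul_distrib, ← Real.rpow_sum_of_pos hr, ← Real.rpow_mul hτ0.le]
      congr 3
      rw [Finset.sum_neg_distrib, Finset.sum_add_distrib, ← Finset.mul_sum, hα]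
      simp only [Finset.sum_const, Finset.card_univ, Fintype.card_fin, nsmul_eq_mul, mul_one]
      field_simp
      ring
    calc _ ≤ (A σ * ∏ j, ENNReal.ofReal (B * τ j ^ (-(α * p)))) ^ (1 / p) := by
          refine ENNReal.rpow_le_rpow ((lintegral_mono hpt).trans ?_) (by positivity)
          rw [hAg σ (fun x => ∏ j, ∏ i, φ j i (x j i)) (by fun_prop)]
          gcongr
      _ = A σ ^ (1 / p) * ∏ j, ψ (τ j) := by
          rw [ENNReal.mul_rpow_of_nonneg _ _ (by positivity),
            ← ENNReal.prod_rpow_of_nonneg (by positivity)]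
          congr 1
          refine Finset.prod_congr rfl fun j _ => ?_
          have := (hτmem j).1
          rw [hψ, Set.indicator_of_mem (hτmem j),
            ENNReal.ofReal_rpow_of_nonneg (by positivity) (by positivity),
            Real.mul_rpow hB0 (by positivity), ← Real.rpow_mul this.le]
          congr 3
          field_simp
      _ ≤ _ := Finset.single_le_sum
          (f := fun σ => A σ ^ (1 / p) * ∏ j, ψ (gridDiff M (s ∘ σ) j)) (fun _ _ => zero_le)
          (Finset.mem_univ σ)

theorem polyWeight_nonneg {d : ℕ} (κ y : Fin d → ℝ) : 0 ≤ polyWeight κ y :=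
  Finset.prod_nonneg fun _ _ => by positivity

@[fun_prop]
theorem measurable_polyWeight {d : ℕ} (κ : Fin d → ℝ) : Measurable (polyWeight κ) := by
  unfold polyWeight
  fun_prop

theorem measurable_sortedEnergy {M d : ℕ} (c H : ℝ) (s : Fin M → ℝ) :
    Measurable (sortedEnergy (d := d) c H s) := by
  unfold sortedEnergy
  simp only [suffixSum_apply]
  fun_prop

theorem ae_injective_and_ne_zero (M : ℕ) :
    ∀ᵐ s : Fin M → ℝ, Function.Injective s ∧ ∀ j, s j ≠ 0 := by
  have h : ∀ f : (Fin M → ℝ) →ₗ[ℝ] ℝ, f ≠ 0 → ∀ᵐ s : Fin M → ℝ, f s ≠ 0 := fun f hf =>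
    measure_mono_null (fun s hs => by simpa using hs)
      (Measure.addHaar_submodule volume (LinearMap.ker f)
        (fun h => hf (LinearMap.ker_eq_top.1 h)))
  have h1 : ∀ i j : Fin M, i ≠ j → ∀ᵐ s : Fin M → ℝ, s i ≠ s j := by
    intro i j hij
    have := h ((LinearMap.proj i : (Fin M → ℝ) →ₗ[ℝ] ℝ) - LinearMap.proj j) (fun h0 => by
      have hz : (Pi.single i 1 : Fin M → ℝ) i - (Pi.single i 1 : Fin M → ℝ) j = 0 :=
        LinearMap.congr_fun h0 (Pi.single i 1)
      simp [hij.symm] at hz)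
    filter_upwards [this] with s hs
    simpa [sub_eq_zero] using hs
  have h2 : ∀ j : Fin M, ∀ᵐ s : Fin M → ℝ, s j ≠ 0 := fun j =>
    h (LinearMap.proj j) (fun h0 => by
      have := LinearMap.congr_fun h0 (Pi.single j 1)
      simp at this)
  have h3 : ∀ᵐ s : Fin M → ℝ, ∀ i j : Fin M, i ≠ j → s i ≠ s j := by
    simp only [ae_all_iff]
    exact h1
  filter_upwards [h3, ae_all_iff.2 h2] with s hs hs'
  exact ⟨fun i j hij => by_contra fun hne => hs i j hne hij, hs'⟩

theorem lintegral_lt_top_of_sortedEnergy_bound {M d : ℕ} {H₁ H₂ c₁ c₂ T : ℝ} (hH₁ : 0 < H₁)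
    (hH₂ : 0 < H₂) (hc₁ : 0 < c₁) (hc₂ : 0 < c₂) (hT : 0 < T) {κ : Fin d → ℝ}
    (hκ : ∀ i, 0 ≤ κ i) (hlt : H₁ * H₂ / (H₁ + H₂) * (2 * ∑ i, κ i + d) < 1)
    {G : (Fin M → (ℝ × ℝ) × (Fin d → ℝ)) → ℝ≥0∞} (hG : Measurable G)
    (hbound : ∀ (s t : Fin M → ℝ) (y : Fin M → Fin d → ℝ), Function.Injective s →
      Function.Injective t → (∀ j, s j ∈ Set.Ioc 0 T) → (∀ j, t j ∈ Set.Ioc 0 T) →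
      G (fun j => ((s j, t j), y j)) ≤ ENNReal.ofReal ((∏ j, polyWeight κ (y j))
        * (Real.exp (-(1 / 2) * sortedEnergy c₁ H₁ s y)
          * Real.exp (-(1 / 2) * sortedEnergy c₂ H₂ t y)))) :
    ∫⁻ z, G z ∂(Measure.pi fun _ : Fin M =>
      ((volume.restrict (Set.Icc 0 T)).prod (volume.restrict (Set.Icc 0 T))).prod volume) < ∞ := by
  set ν : Measure ℝ := volume.restrict (Set.Icc 0 T) with hν
  have hνpi : (Measure.pi fun _ : Fin M => ν)
      = volume.restrict (Set.univ.pi fun _ => Set.Icc 0 T) :=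
    (Measure.restrict_pi_pi _ _).symm
  set p : ℝ := (H₁ + H₂) / H₂ with hp
  set q : ℝ := (H₁ + H₂) / H₁ with hq
  have hpq : p.HolderConjugate q := by
    rw [Real.holderConjugate_iff]
    refine ⟨?_, ?_⟩
    · rw [hp, lt_div_iff₀ hH₂]; linarith
    · rw [hp, hq]; field_simp; ring
  obtain ⟨Ψ₁, hΨ₁m, hΨ₁, hb₁⟩ := exists_lintegral_sortedEnergy_le (M := M) hH₁ hpq.pos hc₁ hT hκ
    (by rw [hp, div_div_eq_mul_div]; exact hlt)
  obtain ⟨Ψ₂, hΨ₂m, hΨ₂, hb₂⟩ := exists_lintegral_sortedEnergy_le (M := M) hH₂ hpq.symm.pos hc₂ hT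
    hκ (by rw [hq, div_div_eq_mul_div, mul_comm H₂]; exact hlt)
  have hgood : ∀ᵐ s ∂(Measure.pi fun _ : Fin M => ν),
      Function.Injective s ∧ ∀ j, s j ∈ Set.Ioc 0 T := by
    rw [hνpi]
    filter_upwards [ae_restrict_of_ae (ae_injective_and_ne_zero M),
      ae_restrict_mem (MeasurableSet.univ_pi fun _ => measurableSet_Icc)] with s hs hs'
    exact ⟨hs.1, fun j => ⟨lt_of_le_of_ne (hs' j trivial).1 (hs.2 j).symm, (hs' j trivial).2⟩⟩
  have hfin : ∀ Ψ : (Fin M → ℝ) → ℝ≥0∞, ∫⁻ s, Ψ s < ∞ →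
      ∫⁻ s, Ψ s ∂(Measure.pi fun _ : Fin M => ν) < ∞ := fun Ψ hΨ => by
    rw [hνpi]; exact (setLIntegral_le_lintegral _ _).trans_lt hΨ
  have e₁ := (measurePreserving_arrowProdEquivProdArrow (ℝ × ℝ) (Fin d → ℝ) (Fin M)
    (fun _ => ν.prod ν) (fun _ => volume)).symm
  have e₂ := (measurePreserving_arrowProdEquivProdArrow ℝ ℝ (Fin M) (fun _ => ν) (fun _ => ν)).symm
  have hGe : Measurable fun a =>
      G ((MeasurableEquiv.arrowProdEquivProdArrow (ℝ × ℝ) (Fin d → ℝ) (Fin M)).symm a) :=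
    hG.comp e₁.measurable
  rw [← e₁.lintegral_comp hG, lintegral_prod _ hGe.aemeasurable,
    ← e₂.lintegral_comp hGe.lintegral_prod_right']
  calc _ ≤ ∫⁻ w : (Fin M → ℝ) × (Fin M → ℝ), Ψ₁ w.1 * Ψ₂ w.2
          ∂((Measure.pi fun _ : Fin M => ν).prod (Measure.pi fun _ : Fin M => ν)) := by
        refine lintegral_mono_ae ?_
        filter_upwards [Measure.quasiMeasurePreserving_fst.ae hgood,
          Measure.quasiMeasurePreserving_snd.ae hgood] with w hw₁ hw₂
        obtain ⟨s, t⟩ := w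
        refine le_trans ?_ (mul_le_mul' (hb₁ s hw₁.1 hw₁.2) (hb₂ t hw₂.1 hw₂.2))
        set W : (Fin M → Fin d → ℝ) → ℝ := fun y => ∏ j, polyWeight κ (y j) with hW
        have hW0 : ∀ y, 0 ≤ W y := fun y => Finset.prod_nonneg fun j _ => polyWeight_nonneg _ _
        have hWm : Measurable W := by fun_prop
        have hsplit : ∀ (r : ℝ), 0 < r → ∀ (c H : ℝ) (u : Fin M → ℝ),
            ∃ f : (Fin M → Fin d → ℝ) → ℝ≥0∞, Measurable f ∧
              (∀ y, f y = ENNReal.ofReal (W y ^ (1 / r)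
                * Real.exp (-(1 / 2) * sortedEnergy c H u y))) ∧
              ∀ y, f y ^ r = ENNReal.ofReal (W y
                * Real.exp (-(r / 2) * sortedEnergy c H u y)) := by
          intro r hr c H u
          have := measurable_sortedEnergy (d := d) c H u
          refine ⟨_, by fun_prop, fun y => rfl, fun y => ?_⟩
          have := hW0 y
          rw [ENNReal.ofReal_rpow_of_nonneg (by positivity) hr.le,
            Real.mul_rpow (by positivity) (by positivity), ← Real.rpow_mul (hW0 y),
            one_div_mul_cancel hr.ne', Real.rpow_one, ← Real.exp_mul]
          congr 3; ring
        obtain ⟨f, hfm, hf, hfp⟩ := hsplit p hpq.pos c₁ H₁ s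
        obtain ⟨g, hgm, hg, hgq⟩ := hsplit q hpq.symm.pos c₂ H₂ t
        have hh := ENNReal.lintegral_mul_le_Lp_mul_Lq volume hpq hfm.aemeasurable hgm.aemeasurable
        simp_rw [hfp, hgq] at hh
        refine le_trans (lintegral_mono fun y => ?_) hh
        refine (hbound s t y hw₁.1 hw₂.1 hw₁.2 hw₂.2).trans (le_of_eq ?_)
        have := hW0 y
        rw [Pi.mul_apply, hf, hg, ← ENNReal.ofReal_mul (by positivity)]
        congr 1
        have h1 : W y ^ (1 / p) * W y ^ (1 / q) = W y := by
          rw [← Real.rpow_add' this]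
          · rw [one_div, one_div, hpq.inv_add_inv_eq_one, Real.rpow_one]
          · rw [one_div, one_div, hpq.inv_add_inv_eq_one]; exact one_ne_zero
        calc W y * _ = (W y ^ (1 / p) * W y ^ (1 / q)) * _ := by rw [h1]
          _ = _ := by ring
    _ = (∫⁻ s, Ψ₁ s ∂(Measure.pi fun _ : Fin M => ν))
          * ∫⁻ s, Ψ₂ s ∂(Measure.pi fun _ : Fin M => ν) :=
        lintegral_prod_mul hΨ₁m.aemeasurable hΨ₂m.aemeasurable
    _ < ∞ := ENNReal.mul_lt_top (hfin _ hΨ₁) (hfin _ hΨ₂)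

/-- The Fourier multiplier of `∂^n p_ε`. -/
def heatSymbol {d : ℕ} (ε : ℝ) (n : Fin d → ℕ) (y : Fin d → ℝ) : ℂ :=
  ∏ i, ((1 / (2 * Real.pi) : ℝ) * (Complex.I * (y i : ℂ)) ^ n i
    * (Real.exp (-(ε / 2) * y i ^ 2) : ℝ))

theorem norm_heatSymbol_le {d : ℕ} {ε : ℝ} (hε : 0 < ε) (n : Fin d → ℕ) (y : Fin d → ℝ) :
    ‖heatSymbol ε n y‖ ≤ ∏ i, |y i| ^ n i := by
  rw [heatSymbol, norm_prod]
  refine Finset.prod_le_prod (fun _ _ => norm_nonneg _) fun i _ => ?_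
  have h1 : |1 / (2 * Real.pi)| ≤ 1 := by
    rw [abs_of_pos (by positivity), div_le_one (by positivity)]
    linarith [Real.pi_gt_three]
  have h2 : |Real.exp (-(ε / 2) * y i ^ 2)| ≤ 1 := by
    rw [abs_of_pos (Real.exp_pos _), Real.exp_le_one_iff]
    nlinarith [sq_nonneg (y i)]
  simp only [norm_mul, norm_pow, Complex.norm_I, one_mul, Complex.norm_real, Real.norm_eq_abs]
  calc _ ≤ 1 * |y i| ^ n i * 1 := by gcongr
    _ = _ := by ring

theorem integrable_heatSymbol {d : ℕ} {ε : ℝ} (hε : 0 < ε) (n : Fin d → ℕ) :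
    Integrable (heatSymbol ε n) := by
  unfold heatSymbol
  refine Integrable.fintype_prod (f := fun i (u : ℝ) => ((1 / (2 * Real.pi) : ℝ) : ℂ)
    * (Complex.I * (u : ℂ)) ^ n i * (Real.exp (-(ε / 2) * u ^ 2) : ℝ)) fun i => ?_
  have h := integrable_rpow_mul_exp_neg_mul_sq (b := ε / 2) (by positivity)
    (s := n i) (by have : (0 : ℝ) ≤ n i := by positivity
                   linarith)
  simp only [Real.rpow_natCast] at h
  refine (h.ofReal.const_mul (((1 / (2 * Real.pi) : ℝ) : ℂ) * Complex.I ^ n i)).congr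
    (Eventually.of_forall fun u => ?_)
  simp only [RCLike.ofReal_eq_complex_ofReal]
  push_cast
  ring

theorem heatSymbol_add_single {d : ℕ} (ε : ℝ) (n : Fin d → ℕ) (i : Fin d) (y : Fin d → ℝ) :
    heatSymbol ε (n + Pi.single i 1) y = Complex.I * y i * heatSymbol ε n y := by
  unfold heatSymbol
  rw [← Finset.mul_prod_erase _ _ (Finset.mem_univ i),
    ← Finset.mul_prod_erase Finset.univ _ (Finset.mem_univ i)]
  rw [Finset.prod_congr rfl fun j hj => by
    rw [Pi.add_apply, Pi.single_eq_of_ne (Finset.ne_of_mem_erase hj), add_zero]]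
  simp only [Pi.add_apply, Pi.single_eq_same, pow_succ]
  ring

/-- The integral representing `∂^n p_ε` in Fourier variables. -/
def heatFourier {d : ℕ} (ε : ℝ) (n : Fin d → ℕ) (z : Fin d → ℝ) : ℂ :=
  ∫ y, heatSymbol ε n y * Complex.exp (Complex.I * ((∑ i, y i * z i : ℝ) : ℂ))

theorem norm_exp_I_mul_ofReal (u : ℝ) : ‖Complex.exp (Complex.I * (u : ℂ))‖ = 1 := by
  rw [mul_comm, Complex.norm_exp_ofReal_mul_I]

theorem integrable_mul_exp_I_mul {α : Type*} [MeasurableSpace α] {μ : Measure α} {f : α → ℂ}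
    (hf : Integrable f μ) {u : α → ℝ} (hu : Measurable u) :
    Integrable (fun a => f a * Complex.exp (Complex.I * (u a : ℂ))) μ := by
  refine hf.mono (hf.aestronglyMeasurable.mul (by fun_prop)) (Eventually.of_forall fun a => ?_)
  rw [norm_mul, norm_exp_I_mul_ofReal, mul_one]

theorem exists_hasFDerivAt_heatFourier {d : ℕ} {ε : ℝ} (hε : 0 < ε) (n : Fin d → ℕ)
    (z : Fin d → ℝ) : ∃ F' : (Fin d → ℝ) →L[ℝ] ℂ, HasFDerivAt (heatFourier ε n) F' z ∧
      ∀ i, F' (Pi.single i 1) = heatFourier ε (n + Pi.single i 1) z := by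
  set F : (Fin d → ℝ) → (Fin d → ℝ) → ℂ := fun z y =>
    heatSymbol ε n y * Complex.exp (Complex.I * ((∑ i, y i * z i : ℝ) : ℂ)) with hF
  set L : Fin d → (Fin d → ℝ) →L[ℝ] ℂ := fun i =>
    Complex.ofRealCLM.comp (ContinuousLinearMap.proj i : (Fin d → ℝ) →L[ℝ] ℝ) with hL
  set F' : (Fin d → ℝ) → (Fin d → ℝ) → (Fin d → ℝ) →L[ℝ] ℂ := fun z y =>
    ∑ i, (heatSymbol ε (n + Pi.single i 1) y
      * Complex.exp (Complex.I * ((∑ i, y i * z i : ℝ) : ℂ))) • L i with hF'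
  have h_int : ∀ m : Fin d → ℕ, ∀ z : Fin d → ℝ, Integrable fun y =>
      heatSymbol ε m y * Complex.exp (Complex.I * ((∑ i, y i * z i : ℝ) : ℂ)) := fun m z =>
    integrable_mul_exp_I_mul (integrable_heatSymbol hε m) (by fun_prop)
  have h_int' : Integrable (F' z) := by
    exact integrable_finsetSum (f := fun i y => (heatSymbol ε (n + Pi.single i 1) y
      * Complex.exp (Complex.I * ((∑ i, y i * z i : ℝ) : ℂ))) • L i) Finset.univ
      fun i _ => (h_int _ z).smul_const (L i)
  have hderiv : ∀ y z, HasFDerivAt (fun z => F z y) (F' z y) z := by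
    intro y z
    have h1 : HasFDerivAt (fun z : Fin d → ℝ => ∑ i, y i * z i)
        (∑ i, y i • (ContinuousLinearMap.proj i : (Fin d → ℝ) →L[ℝ] ℝ)) z := by
      refine HasFDerivAt.fun_sum fun i _ => ?_
      exact (ContinuousLinearMap.proj i : (Fin d → ℝ) →L[ℝ] ℝ).hasFDerivAt.const_mul (y i)
    have h2 := (((Complex.ofRealCLM.hasFDerivAt.comp z h1).const_mul Complex.I).cexp).const_mul
      (heatSymbol ε n y)
    refine h2.congr_fderiv ?_
    ext v
    simp only [hF', hL, heatSymbol_add_single, sum_apply,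
      smul_apply, ContinuousLinearMap.comp_apply, ContinuousLinearMap.proj_apply,
      Complex.ofRealCLM_apply, smul_eq_mul, Finset.mul_sum, Complex.ofReal_sum, Complex.ofReal_mul,
      Function.comp_apply]
    refine Finset.sum_congr rfl fun i _ => ?_
    ring
  have hbd : ∀ y z, ‖F' z y‖ ≤ ∑ i, ‖heatSymbol ε (n + Pi.single i 1) y‖ * ‖L i‖ := fun y z => by
    refine (norm_sum_le _ _).trans (Finset.sum_le_sum fun i _ => ?_)
    rw [norm_smul, norm_mul, norm_exp_I_mul_ofReal, mul_one]
  have hbi : Integrable fun y => ∑ i, ‖heatSymbol ε (n + Pi.single i 1) y‖ * ‖L i‖ :=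
    integrable_finsetSum _ fun i _ => (integrable_heatSymbol hε _).norm.mul_const _
  have hd : HasFDerivAt (fun z => ∫ y, F z y) (∫ y, F' z y) z :=
    hasFDerivAt_integral_of_dominated_of_fderiv_le (s := Set.univ) Filter.univ_mem
      (Eventually.of_forall fun z => (h_int n z).aestronglyMeasurable) (h_int n z)
      h_int'.aestronglyMeasurable (Eventually.of_forall fun y z _ => hbd y z) hbi
      (Eventually.of_forall fun y z _ => hderiv y z)
  refine ⟨_, hd, fun i => ?_⟩
  rw [ContinuousLinearMap.integral_apply h_int', heatFourier]
  refine integral_congr_ae (Eventually.of_forall fun y => ?_)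
  simp [hF', hL, Pi.single_apply, apply_ite Complex.ofReal]

theorem pderivCoord_ofReal_eq_heatFourier {d : ℕ} {ε : ℝ} (hε : 0 < ε) {n : Fin d → ℕ}
    {f : (Fin d → ℝ) → ℝ} (hf : ∀ z, (f z : ℂ) = heatFourier ε n z) (i : Fin d) (z : Fin d → ℝ) :
    (pderivCoord d i f z : ℂ) = heatFourier ε (n + Pi.single i 1) z := by
  obtain ⟨F', hF', hi⟩ := exists_hasFDerivAt_heatFourier hε n z
  have h1 : f = fun z => Complex.reCLM (heatFourier ε n z) := by
    ext w; rw [← hf w]; simp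
  have h2 : HasFDerivAt f (Complex.reCLM.comp F') z := by
    rw [h1]; exact Complex.reCLM.hasFDerivAt.comp z hF'
  have h3 : HasFDerivAt (heatFourier ε n) (Complex.ofRealCLM.comp (Complex.reCLM.comp F')) z := by
    rw [show heatFourier ε n = Complex.ofRealCLM ∘ f from funext fun w => (hf w).symm]
    exact Complex.ofRealCLM.hasFDerivAt.comp z h2
  rw [pderivCoord, h2.fderiv, ← hi, hF'.unique h3]
  simp

theorem heatKernel_eq_heatFourier {d : ℕ} {ε : ℝ} (hε : 0 < ε) (z : Fin d → ℝ) :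
    (heatKernel d ε z : ℂ) = heatFourier ε 0 z := by
  have h := GaussianFourier.integral_cexp_neg_sum_mul_add (ι := Fin d) (b := fun _ => (ε / 2 : ℂ))
    (fun _ => by
      rw [show (ε / 2 : ℂ) = ((ε / 2 : ℝ) : ℂ) by push_cast; ring, Complex.ofReal_re]
      positivity) (fun i => Complex.I * z i)
  have h2 : heatFourier ε 0 z = ((1 / (2 * Real.pi) : ℝ) : ℂ) ^ d *
      ∫ v : Fin d → ℝ, Complex.exp (-∑ i, (ε / 2 : ℂ) * (v i : ℂ) ^ 2
        + ∑ i, Complex.I * z i * v i) := by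
    rw [heatFourier, ← integral_const_mul]
    refine integral_congr_ae (Eventually.of_forall fun y => ?_)
    simp only [heatSymbol, Pi.zero_apply, pow_zero, mul_one, Finset.prod_mul_distrib,
      Finset.prod_const, Finset.card_univ, Fintype.card_fin, Complex.exp_add,
      ← Finset.sum_neg_distrib,
      Complex.exp_sum, Complex.ofReal_exp, mul_assoc]
    congr 2
    · refine Finset.prod_congr rfl fun i _ => ?_
      congr 1; push_cast; ring
    · rw [← Complex.exp_sum]
      congr 1; push_cast; rw [Finset.mul_sum]
      exact Finset.sum_congr rfl fun i _ => by ring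
  rw [h2, h, Finset.prod_mul_distrib, Finset.prod_const, Finset.card_univ, Fintype.card_fin,
    ← Complex.exp_sum, ← mul_assoc, ← mul_pow, heatKernel, Complex.ofReal_mul, Complex.ofReal_exp]
  congr 1
  · rw [show (-(d : ℝ) / 2) = (-(1 / 2)) * d by ring, Real.rpow_mul_natCast (by positivity)]
    push_cast
    congr 1
    rw [show (Real.pi / (ε / 2) : ℂ) = ((Real.pi / (ε / 2) : ℝ) : ℂ) by push_cast; ring,
      show (1 / 2 : ℂ) = ((1 / 2 : ℝ) : ℂ) by push_cast; ring,
      ← Complex.ofReal_cpow (by positivity)]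
    rw [show (1 / (2 * Real.pi) : ℂ) = ((1 / (2 * Real.pi) : ℝ) : ℂ) by push_cast; ring,
      ← Complex.ofReal_mul]
    congr 1
    rw [Real.rpow_neg (by positivity), ← Real.sqrt_eq_rpow, ← Real.sqrt_eq_rpow]
    rw [show Real.pi / (ε / 2) = (2 * Real.pi) ^ 2 / (2 * Real.pi * ε) by field_simp,
      Real.sqrt_div (by positivity), Real.sqrt_sq (by positivity)]
    field_simp
  · congr 1
    push_cast
    rw [neg_div, Finset.sum_div, ← Finset.sum_neg_distrib]
    refine Finset.sum_congr rfl fun i _ => ?_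
    have : (ε : ℂ) ≠ 0 := by exact_mod_cast hε.ne'
    rw [mul_pow, Complex.I_sq]
    field_simp
    ring

theorem heatKernelDeriv_eq_heatFourier {d : ℕ} {ε : ℝ} (hε : 0 < ε) (k : Fin d → ℕ)
    (z : Fin d → ℝ) : (heatKernelDeriv d k ε z : ℂ) = heatFourier ε k z := by
  have hiter : ∀ (i : Fin d) (r : ℕ) (n : Fin d → ℕ) (f : (Fin d → ℝ) → ℝ),
      (∀ z, (f z : ℂ) = heatFourier ε n z) →
      ∀ z, ((pderivCoord d i)^[r] f z : ℂ) = heatFourier ε (n + Pi.single i r) z := by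
    intro i r n f hf
    induction r with
    | zero => simpa using hf
    | succ r ih =>
      intro z
      rw [Function.iterate_succ_apply', pderivCoord_ofReal_eq_heatFourier hε ih, add_assoc,
        ← Pi.single_add]
  have hlist : ∀ (l : List (Fin d)) (z), ((l.foldr (fun i g => (pderivCoord d i)^[k i] g)
      (heatKernel d ε) z : ℝ) : ℂ) = heatFourier ε (l.map fun i => Pi.single i (k i)).sum z := by
    intro l
    induction l with
    | nil => exact heatKernel_eq_heatFourier hε
    | cons i l ih =>
      intro z
      rw [List.foldr_cons, hiter i (k i) _ _ ih, List.map_cons, List.sum_cons, add_comm]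
  rw [heatKernelDeriv, multiPDeriv, hlist]
  congr 1
  rw [← List.ofFn_eq_map, List.sum_ofFn, Finset.univ_sum_single]

theorem sortedEnergy_le_sum_variance {M d : ℕ} {Ω : Type*} [MeasurableSpace Ω] {P : Measure Ω}
    {Y : ℝ → Ω → Fin d → ℝ} {c H T : ℝ} (hT : 0 < T)
    (hLND : ∀ s : ℕ → ℝ, s 0 = 0 → (∀ j, j < M → s j < s (j + 1)) → s M < 2 * T →
      ∀ x : Fin M → ℝ, ∀ i : Fin d,
        c * ∑ j : Fin M, (x j) ^ 2 * (s ((j : ℕ) + 1) - s (j : ℕ)) ^ (2 * H)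
          ≤ variance
              (fun ω => ∑ j : Fin M, x j * (Y (s ((j : ℕ) + 1)) ω i - Y (s (j : ℕ)) ω i)) P)
    {s : Fin M → ℝ} (hs : Function.Injective s) (hsT : ∀ j, s j ∈ Set.Ioc 0 T)
    (y : Fin M → Fin d → ℝ) :
    sortedEnergy c H s y ≤ ∑ i, variance (fun ω => ∑ j : Fin (M + 1),
      (Fin.cons (-∑ j, y j) y : Fin (M + 1) → Fin d → ℝ) j i
        * Y ((Fin.cons 0 s : Fin (M + 1) → ℝ) j) ω i) P := by
  set σ := Tuple.sort s with hσ
  have hmono : StrictMono (s ∘ σ) :=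
    (Tuple.monotone_sort s).strictMono_of_injective (hs.comp σ.injective)
  have hgrid : ∀ j, j < M → gridSeq (s ∘ σ) j < gridSeq (s ∘ σ) (j + 1) := by
    intro j hj
    rw [gridSeq_succ (s ∘ σ) ⟨j, hj⟩]
    rcases j with _ | j
    · exact (hsT _).1
    · rw [gridSeq_succ (s ∘ σ) ⟨j, by omega⟩]
      exact hmono (by simp [Fin.lt_def])
  have hlast : gridSeq (s ∘ σ) M < 2 * T := by
    rcases M with _ | M
    · simpa using hT
    · rw [gridSeq_succ (s ∘ σ) ⟨M, by omega⟩]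
      have := (hsT (σ ⟨M, by omega⟩)).2
      simp only [Function.comp_apply]
      linarith
  rw [sortedEnergy, Finset.mul_sum]
  refine Finset.sum_le_sum fun i _ => ?_
  refine (hLND (gridSeq (s ∘ σ)) rfl hgrid hlast
    (suffixSum M ℝ fun l => y (σ l) i) i).trans_eq ?_
  congr 1
  ext ω
  rw [sum_suffixSum_mul_increment (fun l => y (σ l) i) (s ∘ σ) (fun t => Y t ω i),
    Fin.sum_univ_succ]
  simp only [Fin.cons_zero, Fin.cons_succ, Pi.neg_apply, Finset.sum_apply, Function.comp_apply]
  rw [Equiv.sum_comp σ (fun l => y l i * Y (s l) ω i), Equiv.sum_comp σ (fun l => y l i)]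
  ring

theorem norm_integral_exp_I_mul_of_map_eq_gaussianReal {Ω : Type*} [MeasurableSpace Ω]
    {P : Measure Ω} {W : Ω → ℝ} (hW : Measurable W) {v : ℝ} (hv : 0 ≤ v)
    (h : P.map W = gaussianReal 0 v.toNNReal) :
    ‖∫ ω, Complex.exp (Complex.I * (W ω : ℂ)) ∂P‖ = Real.exp (-(1 / 2) * v) := by
  have h1 : ∫ ω, Complex.exp (Complex.I * (W ω : ℂ)) ∂P = charFun (P.map W) 1 := by
    rw [charFun_apply_real, integral_map hW.aemeasurable (by fun_prop)]
    simp [mul_comm]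
  rw [h1, h, charFun_gaussianReal, Complex.norm_exp]
  congr 1
  simp [Real.coe_toNNReal _ hv]
  ring

/-- The increment `(X_t - X_0) - (X̃_s - X̃_0)` at the pair of times `q = (t, s)`. -/
def incrementDiff {d : ℕ} {Ω : Type*} (X Xt : ℝ → Ω → Fin d → ℝ) (q : ℝ × ℝ) (ω : Ω) :
    Fin d → ℝ := fun i => (X q.1 ω i - X 0 ω i) - (Xt q.2 ω i - Xt 0 ω i)

theorem measurable_incrementDiff {d : ℕ} {Ω : Type*} [MeasurableSpace Ω]
    {X Xt : ℝ → Ω → Fin d → ℝ} (hX : Measurable fun q : ℝ × Ω => X q.1 q.2)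
    (hXt : Measurable fun q : ℝ × Ω => Xt q.1 q.2) :
    Measurable fun p : (ℝ × ℝ) × Ω => incrementDiff X Xt p.1 p.2 := by
  have h : ∀ Y : ℝ → Ω → Fin d → ℝ, (Measurable fun q : ℝ × Ω => Y q.1 q.2) →
      ∀ u : (ℝ × ℝ) × Ω → ℝ, Measurable u → ∀ i, Measurable fun p => Y (u p) p.2 i :=
    fun Y hY u hu i => (measurable_pi_apply i).comp (hY.comp (hu.prodMk measurable_snd))
  refine measurable_pi_lambda _ fun i => ?_
  exact ((h X hX _ (measurable_fst.comp measurable_fst) i).sub (h X hX _ measurable_const i)).sub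
    ((h Xt hXt _ (measurable_snd.comp measurable_fst) i).sub (h Xt hXt _ measurable_const i))

theorem norm_integral_exp_incrementDiff_le {M d : ℕ} {Ω : Type*} [MeasurableSpace Ω]
    {P : Measure Ω} {X Xt : ℝ → Ω → Fin d → ℝ}
    (hX : Measurable fun q : ℝ × Ω => X q.1 q.2) (hXt : Measurable fun q : ℝ × Ω => Xt q.1 q.2)
    (hGauss : ∀ (m : ℕ) (s t : Fin m → ℝ), (∀ j, 0 ≤ s j) → (∀ j, 0 ≤ t j) →
      ∀ y : Fin m → Fin d → ℝ,
      Measure.map (fun ω => ∑ j, ∑ i, y j i * (X (s j) ω i - Xt (t j) ω i)) P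
        = gaussianReal 0
            (Real.toNNReal
              (variance (fun ω => ∑ j, ∑ i, y j i * (X (s j) ω i - Xt (t j) ω i)) P)))
    (hVarSplit : ∀ (m : ℕ) (s t : Fin m → ℝ), (∀ j, 0 ≤ s j) → (∀ j, 0 ≤ t j) →
      ∀ y : Fin m → Fin d → ℝ,
      variance (fun ω => ∑ j, ∑ i, y j i * (X (s j) ω i - Xt (t j) ω i)) P
        = variance (fun ω => ∑ j, ∑ i, y j i * X (s j) ω i) P
          + variance (fun ω => ∑ j, ∑ i, y j i * Xt (t j) ω i) P)
    (hVarCoordX : ∀ (m : ℕ) (s : Fin m → ℝ), (∀ j, 0 ≤ s j) →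
      ∀ y : Fin m → Fin d → ℝ,
      variance (fun ω => ∑ j, ∑ i, y j i * X (s j) ω i) P
        = ∑ i, variance (fun ω => ∑ j, y j i * X (s j) ω i) P)
    (hVarCoordXt : ∀ (m : ℕ) (t : Fin m → ℝ), (∀ j, 0 ≤ t j) →
      ∀ y : Fin m → Fin d → ℝ,
      variance (fun ω => ∑ j, ∑ i, y j i * Xt (t j) ω i) P
        = ∑ i, variance (fun ω => ∑ j, y j i * Xt (t j) ω i) P)
    {s t : Fin M → ℝ} (hs : ∀ j, 0 ≤ s j) (ht : ∀ j, 0 ≤ t j) (y : Fin M → Fin d → ℝ)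
    {e₁ e₂ : ℝ}
    (he₁ : e₁ ≤ ∑ i, variance (fun ω => ∑ j : Fin (M + 1),
      (Fin.cons (-∑ j, y j) y : Fin (M + 1) → Fin d → ℝ) j i
        * X ((Fin.cons 0 s : Fin (M + 1) → ℝ) j) ω i) P)
    (he₂ : e₂ ≤ ∑ i, variance (fun ω => ∑ j : Fin (M + 1),
      (Fin.cons (-∑ j, y j) y : Fin (M + 1) → Fin d → ℝ) j i
        * Xt ((Fin.cons 0 t : Fin (M + 1) → ℝ) j) ω i) P) :
    ‖∫ ω, Complex.exp (Complex.I *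
        ((∑ j, ∑ i, y j i * incrementDiff X Xt (s j, t j) ω i : ℝ) : ℂ)) ∂P‖
      ≤ Real.exp (-(1 / 2) * e₁) * Real.exp (-(1 / 2) * e₂) := by
  set y' : Fin (M + 1) → Fin d → ℝ := Fin.cons (-∑ j, y j) y with hy'
  set s' : Fin (M + 1) → ℝ := Fin.cons 0 s with hs'
  set t' : Fin (M + 1) → ℝ := Fin.cons 0 t with ht'
  have hs0 : ∀ j, 0 ≤ s' j := Fin.cases (by simp [hs']) (by simpa [hs'] using hs)
  have ht0 : ∀ j, 0 ≤ t' j := Fin.cases (by simp [ht']) (by simpa [ht'] using ht)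
  have hW : ∀ ω, ∑ j, ∑ i, y j i * incrementDiff X Xt (s j, t j) ω i
      = ∑ j, ∑ i, y' j i * (X (s' j) ω i - Xt (t' j) ω i) := by
    intro ω
    rw [Fin.sum_univ_succ]
    simp only [hy', hs', ht', Fin.cons_zero, Fin.cons_succ, Pi.neg_apply, Finset.sum_apply,
      incrementDiff]
    simp only [neg_mul, Finset.sum_neg_distrib, Finset.sum_mul]
    rw [Finset.sum_comm (s := Finset.univ (α := Fin d)), ← sub_eq_neg_add,
      ← Finset.sum_sub_distrib]
    refine Finset.sum_congr rfl fun j _ => ?_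
    rw [← Finset.sum_sub_distrib]
    exact Finset.sum_congr rfl fun i _ => by ring
  simp_rw [hW]
  have hm : ∀ {Y : ℝ → Ω → Fin d → ℝ}, (Measurable fun q : ℝ × Ω => Y q.1 q.2) →
      ∀ (u : ℝ) (i : Fin d), Measurable fun ω => Y u ω i := fun hY u i =>
    (measurable_pi_apply i).comp (hY.comp (measurable_const.prodMk measurable_id))
  have hWm : Measurable fun ω => ∑ j, ∑ i, y' j i * (X (s' j) ω i - Xt (t' j) ω i) :=
    Finset.measurable_sum _ fun j _ => Finset.measurable_sum _ fun i _ =>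
      ((hm hX _ i).sub (hm hXt _ i)).const_mul _
  rw [norm_integral_exp_I_mul_of_map_eq_gaussianReal hWm (variance_nonneg _ _)
    (hGauss _ s' t' hs0 ht0 y'), ← Real.exp_add, hVarSplit _ s' t' hs0 ht0 y',
    hVarCoordX _ s' hs0 y', hVarCoordXt _ t' ht0 y']
  refine Real.exp_le_exp.2 ?_
  linarith

/-- The integrand bounding the `M`-th moment of an integral of trigonometric exponentials. -/
def momentKernel {M d : ℕ} {Ω Q : Type*} [MeasurableSpace Ω] (P : Measure Ω) (κ : Fin d → ℝ)
    (Z : Q → Ω → Fin d → ℝ) (z : Fin M → Q × (Fin d → ℝ)) : ℝ≥0∞ :=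
  ENNReal.ofReal (∏ j, polyWeight κ (z j).2) *
    ‖∫ ω, Complex.exp (Complex.I * ((∑ j, ∑ i, (z j).2 i * Z (z j).1 ω i : ℝ) : ℂ)) ∂P‖ₑ

section

variable {M d : ℕ} {Ω Q : Type*} [MeasurableSpace Ω] [MeasurableSpace Q] {P : Measure Ω}
  {Z : Q → Ω → Fin d → ℝ}

theorem measurable_phase (hZ : Measurable fun p : Q × Ω => Z p.1 p.2) :
    Measurable fun p : (Fin M → Q × (Fin d → ℝ)) × Ω =>
      ∑ j, ∑ i, (p.1 j).2 i * Z (p.1 j).1 p.2 i := by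
  refine Finset.measurable_sum _ fun j _ => Finset.measurable_sum _ fun i _ => ?_
  refine Measurable.mul (by fun_prop) ?_
  exact (measurable_pi_apply i).comp (hZ.comp (Measurable.prodMk (by fun_prop) measurable_snd))

theorem measurable_momentKernel [SFinite P] (κ : Fin d → ℝ)
    (hZ : Measurable fun p : Q × Ω => Z p.1 p.2) :
    Measurable (momentKernel (M := M) P κ Z) := by
  have h := (measurable_phase (M := M) hZ)
  have h2 : Measurable fun p : (Fin M → Q × (Fin d → ℝ)) × Ω =>
      Complex.exp (Complex.I * ((∑ j, ∑ i, (p.1 j).2 i * Z (p.1 j).1 p.2 i : ℝ) : ℂ)) := by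
    fun_prop
  have h3 := (h2.stronglyMeasurable.integral_prod_right' (ν := P)).measurable
  unfold momentKernel
  fun_prop

theorem lintegral_enorm_pow_le_lintegral_momentKernel [IsProbabilityMeasure P] {τ : Measure Q}
    [IsFiniteMeasure τ] {κ : Fin d → ℝ} (hZ : Measurable fun p : Q × Ω => Z p.1 p.2)
    {g : (Fin d → ℝ) → ℂ} (hg : Integrable g) {A : ℝ} (hA : 0 ≤ A)
    (hgA : ∀ y, ‖g y‖ ≤ A * polyWeight κ y) {D : Ω → ℝ}
    (hD : ∀ ω, (D ω : ℂ) = ∫ q, (∫ y, g y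
      * Complex.exp (Complex.I * ((∑ i, y i * Z q ω i : ℝ) : ℂ))) ∂τ) (hM : Even M) :
    ∫⁻ ω, ‖D ω‖ₑ ^ M ∂P ≤ ENNReal.ofReal (A ^ M) *
      ∫⁻ z, momentKernel P κ Z z ∂(Measure.pi fun _ : Fin M => τ.prod volume) := by
  set π : Measure (Fin M → Q × (Fin d → ℝ)) := Measure.pi fun _ => τ.prod volume with hπ
  set u : (Fin M → Q × (Fin d → ℝ)) → Ω → ℝ := fun z ω =>
    ∑ j, ∑ i, (z j).2 i * Z (z j).1 ω i with hu
  have hum : Measurable fun p : (Fin M → Q × (Fin d → ℝ)) × Ω => u p.1 p.2 := measurable_phase hZ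
  have hgint : Integrable (fun p : Q × (Fin d → ℝ) => g p.2) (τ.prod volume) := hg.comp_snd τ
  have hprod : Integrable (fun z : Fin M → Q × (Fin d → ℝ) => ∏ j, g (z j).2) π :=
    Integrable.fintype_prod (f := fun (_ : Fin M) (p : Q × (Fin d → ℝ)) => g p.2) fun _ => hgint
  have hpow : ∀ ω, ((D ω ^ M : ℝ) : ℂ) = ∫ z, (∏ j, g (z j).2)
      * Complex.exp (Complex.I * (u z ω : ℂ)) ∂π := by
    intro ω
    have hZω : Measurable fun q => Z q ω := hZ.comp (measurable_id.prodMk measurable_const)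
    have hv : Measurable fun p : Q × (Fin d → ℝ) => ∑ i, p.2 i * Z p.1 ω i :=
      Finset.measurable_sum _ fun i _ => Measurable.mul (by fun_prop)
        ((measurable_pi_apply i).comp (hZω.comp measurable_fst))
    rw [Complex.ofReal_pow, hD, ← integral_prod (fun p : Q × (Fin d → ℝ) => g p.2
      * Complex.exp (Complex.I * ((∑ i, p.2 i * Z p.1 ω i : ℝ) : ℂ)))
      (integrable_mul_exp_I_mul hgint hv)]
    have := integral_fintype_prod_eq_pow (ι := Fin M) (μ := τ.prod volume)
      (fun p : Q × (Fin d → ℝ) => g p.2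
        * Complex.exp (Complex.I * ((∑ i, p.2 i * Z p.1 ω i : ℝ) : ℂ)))
    rw [Fintype.card_fin] at this
    rw [← this]
    refine integral_congr_ae (Eventually.of_forall fun z => ?_)
    simp only [hu]
    rw [Finset.prod_mul_distrib, ← Complex.exp_sum, Complex.ofReal_sum, Finset.mul_sum]
  have h_int : Integrable (fun p : Ω × (Fin M → Q × (Fin d → ℝ)) => (∏ j, g (p.2 j).2)
      * Complex.exp (Complex.I * (u p.2 p.1 : ℂ))) (P.prod π) :=
    integrable_mul_exp_I_mul (hprod.comp_snd P) (hum.comp measurable_swap)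
  have hDint : Integrable (fun ω => D ω ^ M) P := by
    have := h_int.integral_prod_left
    simp only [← hpow] at this
    exact this.re
  calc ∫⁻ ω, ‖D ω‖ₑ ^ M ∂P = ∫⁻ ω, ENNReal.ofReal (D ω ^ M) ∂P := by
        refine lintegral_congr fun ω => ?_
        rw [← enorm_pow, Real.enorm_of_nonneg (hM.pow_nonneg _)]
    _ = ENNReal.ofReal (∫ ω, D ω ^ M ∂P) :=
        (ofReal_integral_eq_lintegral_ofReal hDint
          (Eventually.of_forall fun ω => hM.pow_nonneg _)).symm
    _ ≤ ‖∫ ω, ((D ω ^ M : ℝ) : ℂ) ∂P‖ₑ := by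
        rw [integral_complex_ofReal, ← ofReal_norm, Complex.norm_real]
        exact ENNReal.ofReal_le_ofReal (le_abs_self _)
    _ = ‖∫ z, (∏ j, g (z j).2) * ∫ ω, Complex.exp (Complex.I * (u z ω : ℂ)) ∂P ∂π‖ₑ := by
        simp_rw [hpow]
        rw [integral_integral_swap h_int]
        simp_rw [integral_const_mul]
    _ ≤ ∫⁻ z, ‖(∏ j, g (z j).2) * ∫ ω, Complex.exp (Complex.I * (u z ω : ℂ)) ∂P‖ₑ ∂π :=
        enorm_integral_le_lintegral_enorm _
    _ ≤ ∫⁻ z, ENNReal.ofReal (A ^ M) * momentKernel P κ Z z ∂π := by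
        refine lintegral_mono fun z => ?_
        rw [enorm_mul, momentKernel, ← mul_assoc, ← ENNReal.ofReal_mul (by positivity)]
        refine mul_le_mul' ?_ le_rfl
        rw [← ofReal_norm, norm_prod]
        refine ENNReal.ofReal_le_ofReal ?_
        calc ∏ j, ‖g (z j).2‖ ≤ ∏ j, (A * polyWeight κ (z j).2) :=
              Finset.prod_le_prod (fun _ _ => norm_nonneg _) fun j _ => hgA _
          _ = _ := by simp [Finset.prod_mul_distrib]
    _ = _ := lintegral_const_mul _ (measurable_momentKernel κ hZ)

end

theorem sum_le_prod_one_add {ι : Type*} (s : Finset ι) {a : ι → ℝ} (ha : ∀ i, 0 ≤ a i) :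
    1 + ∑ i ∈ s, a i ≤ ∏ i ∈ s, (1 + a i) := by
  classical
  induction s using Finset.induction_on with
  | empty => simp
  | insert i s hi ih =>
    rw [Finset.sum_insert hi, Finset.prod_insert hi]
    have h1 : 0 ≤ ∑ i ∈ s, a i := Finset.sum_nonneg fun i _ => ha i
    nlinarith [ha i, mul_le_mul_of_nonneg_left ih (ha i), mul_nonneg (ha i) h1]

theorem norm_exp_I_mul_sub_one_le_rpow {δ : ℝ} (hδ : 0 < δ) (hδ1 : δ ≤ 1) (u : ℝ) :
    ‖Complex.exp (Complex.I * (u : ℂ)) - 1‖ ≤ 2 * |u| ^ δ := by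
  rcases le_total |u| 1 with hu | hu
  · have h1 : ‖Complex.exp (Complex.I * (u : ℂ)) - 1‖ ≤ |u| := Real.norm_exp_I_mul_ofReal_sub_one_le
    have h2 : |u| ≤ |u| ^ δ := by
      rcases (abs_nonneg u).eq_or_lt with h0 | h0
      · rw [← h0, Real.zero_rpow hδ.ne']
      · simpa using Real.rpow_le_rpow_of_exponent_ge h0 hu hδ1
    linarith [abs_nonneg u]
  · have h1 : ‖Complex.exp (Complex.I * (u : ℂ)) - 1‖ ≤ 1 + 1 :=
      (norm_sub_le _ _).trans (by rw [norm_exp_I_mul_ofReal, norm_one])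
    have := Real.one_le_rpow hu hδ.le
    linarith

theorem norm_exp_sub_exp_le {d : ℕ} {δ : ℝ} (hδ : 0 < δ) (hδ1 : δ ≤ 1) (y a b : Fin d → ℝ) :
    ‖Complex.exp (Complex.I * ((∑ i, y i * a i : ℝ) : ℂ))
        - Complex.exp (Complex.I * ((∑ i, y i * b i : ℝ) : ℂ))‖
      ≤ 2 * ‖a - b‖ ^ δ * ∏ i, (1 + |y i|) ^ δ := by
  have h1 : Complex.exp (Complex.I * ((∑ i, y i * a i : ℝ) : ℂ))
        - Complex.exp (Complex.I * ((∑ i, y i * b i : ℝ) : ℂ))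
      = Complex.exp (Complex.I * ((∑ i, y i * b i : ℝ) : ℂ))
        * (Complex.exp (Complex.I * ((∑ i, y i * (a i - b i) : ℝ) : ℂ)) - 1) := by
    rw [mul_sub, ← Complex.exp_add, mul_one, ← mul_add, ← Complex.ofReal_add,
      ← Finset.sum_add_distrib]
    congr 4
    exact Finset.sum_congr rfl fun i _ => by ring
  have h2 : |∑ i, y i * (a i - b i)| ≤ ‖a - b‖ * ∏ i, (1 + |y i|) := by
    calc _ ≤ ∑ i, |y i| * ‖a - b‖ := by
          refine (Finset.abs_sum_le_sum_abs _ _).trans (Finset.sum_le_sum fun i _ => ?_)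
          rw [abs_mul]
          exact mul_le_mul_of_nonneg_left (norm_le_pi_norm (a - b) i) (abs_nonneg _)
      _ = ‖a - b‖ * ∑ i, |y i| := by rw [← Finset.sum_mul, mul_comm]
      _ ≤ _ := by
          refine mul_le_mul_of_nonneg_left ?_ (norm_nonneg _)
          linarith [sum_le_prod_one_add Finset.univ fun i => abs_nonneg (y i)]
  rw [h1, norm_mul, norm_exp_I_mul_ofReal, one_mul, mul_assoc]
  refine (norm_exp_I_mul_sub_one_le_rpow hδ hδ1 _).trans ?_
  refine mul_le_mul_of_nonneg_left ?_ zero_le_two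
  rw [Real.finsetProd_rpow _ _ fun i _ => by positivity,
    ← Real.mul_rpow (norm_nonneg _) (Finset.prod_nonneg fun i _ => by positivity)]
  exact Real.rpow_le_rpow (abs_nonneg _) h2 hδ.le

theorem continuous_heatKernelDeriv {d : ℕ} {ε : ℝ} (hε : 0 < ε) (k : Fin d → ℕ) :
    Continuous (heatKernelDeriv d k ε) := by
  have h : Continuous (heatFourier ε k) := continuous_iff_continuousAt.2 fun z => by
    obtain ⟨F', hF', -⟩ := exists_hasFDerivAt_heatFourier hε k z
    exact hF'.continuousAt
  have h2 : heatKernelDeriv d k ε = fun z => (heatFourier ε k z).re := by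
    ext z
    rw [← heatKernelDeriv_eq_heatFourier hε]
    simp
  rw [h2]
  exact Complex.continuous_re.comp h

theorem abs_heatKernelDeriv_le {d : ℕ} {ε : ℝ} (hε : 0 < ε) (k : Fin d → ℕ) (z : Fin d → ℝ) :
    |heatKernelDeriv d k ε z| ≤ ∫ y, ‖heatSymbol ε k y‖ := by
  rw [← Real.norm_eq_abs, ← Complex.norm_real, heatKernelDeriv_eq_heatFourier hε, heatFourier]
  refine (norm_integral_le_integral_norm _).trans_eq ?_
  simp only [norm_mul, norm_exp_I_mul_ofReal, mul_one]

/-- The integral of `∂^k p_ε` along a random field, shifted by `a`. -/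
def shiftedOccupation {d : ℕ} {Ω Q : Type*} [MeasurableSpace Q] (k : Fin d → ℕ)
    (ε : ℝ) (τ : Measure Q) (Z : Q → Ω → Fin d → ℝ) (a : Fin d → ℝ) (ω : Ω) : ℝ :=
  ∫ q, heatKernelDeriv d k ε (Z q ω + a) ∂τ

theorem shiftedOccupation_eq_fourier {d : ℕ} {Ω Q : Type*} [MeasurableSpace Q]
    {τ : Measure Q} {Z : Q → Ω → Fin d → ℝ} {ε : ℝ} {k : Fin d → ℕ} (hε : 0 < ε)
    (a : Fin d → ℝ) (ω : Ω) :
    (shiftedOccupation k ε τ Z a ω : ℂ) = ∫ q, (∫ y, heatSymbol ε k y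
      * Complex.exp (Complex.I * ((∑ i, y i * a i : ℝ) : ℂ))
      * Complex.exp (Complex.I * ((∑ i, y i * Z q ω i : ℝ) : ℂ))) ∂τ := by
  rw [shiftedOccupation, ← integral_complex_ofReal]
  refine integral_congr_ae (Eventually.of_forall fun q => ?_)
  simp only [heatKernelDeriv_eq_heatFourier hε, heatFourier]
  refine integral_congr_ae (Eventually.of_forall fun y => ?_)
  simp only
  rw [mul_assoc, ← Complex.exp_add, ← mul_add, ← Complex.ofReal_add, ← Finset.sum_add_distrib]
  congr 4
  exact Finset.sum_congr rfl fun i _ => by rw [Pi.add_apply]; ring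

section

variable {d : ℕ} {Ω Q : Type*} [MeasurableSpace Ω] [MeasurableSpace Q]

variable {τ : Measure Q} [IsFiniteMeasure τ] {Z : Q → Ω → Fin d → ℝ} {ε : ℝ} {k : Fin d → ℕ}

theorem measurable_section_of_prod (hZ : Measurable fun p : Q × Ω => Z p.1 p.2) (ω : Ω) :
    Measurable fun q => Z q ω :=
  hZ.comp (measurable_id.prodMk measurable_const)

theorem integrable_heatKernelDeriv_comp (hε : 0 < ε)
    (hZ : Measurable fun p : Q × Ω => Z p.1 p.2) (a : Fin d → ℝ) (ω : Ω) :
    Integrable (fun q => heatKernelDeriv d k ε (Z q ω + a)) τ := by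
  refine Integrable.of_bound (C := ∫ y, ‖heatSymbol ε k y‖) ?_
    (Eventually.of_forall fun q => abs_heatKernelDeriv_le hε k _)
  exact ((continuous_heatKernelDeriv hε k).measurable.comp
    ((measurable_section_of_prod hZ ω).add_const a)).aestronglyMeasurable

theorem measurable_shiftedOccupation (hε : 0 < ε) (hZ : Measurable fun p : Q × Ω => Z p.1 p.2) :
    Measurable fun p : (Fin d → ℝ) × Ω => shiftedOccupation k ε τ Z p.1 p.2 := by
  have h : Measurable fun p : ((Fin d → ℝ) × Ω) × Q =>
      heatKernelDeriv d k ε (Z p.2 p.1.2 + p.1.1) :=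
    (continuous_heatKernelDeriv hε k).measurable.comp
      ((hZ.comp (measurable_snd.prodMk (measurable_snd.comp measurable_fst))).add
        (measurable_fst.comp measurable_fst))
  exact (h.stronglyMeasurable.integral_prod_right' (ν := τ)).measurable

theorem continuous_shiftedOccupation (hε : 0 < ε) (hZ : Measurable fun p : Q × Ω => Z p.1 p.2)
    (ω : Ω) : Continuous fun a => shiftedOccupation k ε τ Z a ω := by
  refine continuous_of_dominated (bound := fun _ => ∫ y, ‖heatSymbol ε k y‖)
    (fun a => (integrable_heatKernelDeriv_comp hε hZ a ω).aestronglyMeasurable)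
    (fun a => Eventually.of_forall fun q => abs_heatKernelDeriv_le hε k _)
    (integrable_const _) (Eventually.of_forall fun q => ?_)
  exact (continuous_heatKernelDeriv hε k).comp (by fun_prop)

theorem integrable_symbol_mul_exp (hε : 0 < ε) (a : Fin d → ℝ) :
    Integrable fun y => heatSymbol ε k y
      * Complex.exp (Complex.I * ((∑ i, y i * a i : ℝ) : ℂ)) :=
  integrable_mul_exp_I_mul (integrable_heatSymbol hε k) (by fun_prop)

theorem norm_heatSymbol_mul_le (hε : 0 < ε) {δ : ℝ} (y : Fin d → ℝ) :
    ‖heatSymbol ε k y‖ * ∏ i, (1 + |y i|) ^ δ ≤ polyWeight (fun i => k i + δ) y := by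
  refine (mul_le_mul_of_nonneg_right (norm_heatSymbol_le hε k y)
    (Finset.prod_nonneg fun i _ => by positivity)).trans ?_
  rw [← Finset.prod_mul_distrib, polyWeight]
  refine Finset.prod_le_prod (fun i _ => by positivity) fun i _ => ?_
  rw [Real.rpow_add (by positivity), Real.rpow_natCast]
  gcongr
  linarith

variable {P : Measure Ω} [IsProbabilityMeasure P]

theorem lintegral_shiftedOccupation_le (hε : 0 < ε)
    (hZ : Measurable fun p : Q × Ω => Z p.1 p.2) {δ : ℝ} (hδ : 0 < δ) {M : ℕ} (hM : Even M)
    (a : Fin d → ℝ) :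
    ∫⁻ ω, ‖shiftedOccupation k ε τ Z a ω‖ₑ ^ M ∂P ≤
      ∫⁻ z, momentKernel P (fun i => k i + δ) Z z
        ∂(Measure.pi fun _ : Fin M => τ.prod volume) := by
  refine (lintegral_enorm_pow_le_lintegral_momentKernel (κ := fun i => k i + δ) hZ
    (integrable_symbol_mul_exp (k := k) hε a) zero_le_one (fun y => ?_)
    (shiftedOccupation_eq_fourier hε a) hM).trans_eq (by simp)
  rw [norm_mul, norm_exp_I_mul_ofReal, mul_one, one_mul]
  refine le_trans ?_ (norm_heatSymbol_mul_le hε y)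
  refine le_mul_of_one_le_right (norm_nonneg _) ?_
  exact Finset.one_le_prod fun i _ => Real.one_le_rpow (by linarith [abs_nonneg (y i)]) hδ.le

theorem lintegral_shiftedOccupation_sub_le (hε : 0 < ε)
    (hZ : Measurable fun p : Q × Ω => Z p.1 p.2) {δ : ℝ} (hδ : 0 < δ) (hδ1 : δ ≤ 1) {M : ℕ}
    (hM : Even M) (a b : Fin d → ℝ) :
    ∫⁻ ω, ‖shiftedOccupation k ε τ Z a ω - shiftedOccupation k ε τ Z b ω‖ₑ ^ M ∂P ≤
      ENNReal.ofReal ((2 * ‖a - b‖ ^ δ) ^ M) *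
      ∫⁻ z, momentKernel P (fun i => k i + δ) Z z
        ∂(Measure.pi fun _ : Fin M => τ.prod volume) := by
  have h_int := fun a : Fin d → ℝ => integrable_symbol_mul_exp (k := k) hε a
  refine lintegral_enorm_pow_le_lintegral_momentKernel (κ := fun i => k i + δ) hZ
    ((h_int a).sub (h_int b)) (by positivity) (fun y => ?_) (fun ω => ?_) hM
  · rw [Pi.sub_apply, ← mul_sub, norm_mul]
    calc _ ≤ ‖heatSymbol ε k y‖ * (2 * ‖a - b‖ ^ δ * ∏ i, (1 + |y i|) ^ δ) := by
          gcongr; exact norm_exp_sub_exp_le hδ hδ1 y a b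
      _ = 2 * ‖a - b‖ ^ δ * (‖heatSymbol ε k y‖ * ∏ i, (1 + |y i|) ^ δ) := by ring
      _ ≤ _ := by gcongr; exact norm_heatSymbol_mul_le hε y
  · have hq : ∀ a : Fin d → ℝ, Integrable (fun q => ∫ y, heatSymbol ε k y
        * Complex.exp (Complex.I * ((∑ i, y i * a i : ℝ) : ℂ))
        * Complex.exp (Complex.I * ((∑ i, y i * Z q ω i : ℝ) : ℂ))) τ := by
      intro a
      have hZω := measurable_section_of_prod hZ ω
      refine Integrable.integral_prod_left (μ := τ) (ν := volume)
        (f := fun p : Q × (Fin d → ℝ) => heatSymbol ε k p.2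
        * Complex.exp (Complex.I * ((∑ i, p.2 i * a i : ℝ) : ℂ))
        * Complex.exp (Complex.I * ((∑ i, p.2 i * Z p.1 ω i : ℝ) : ℂ))) ?_
      exact integrable_mul_exp_I_mul ((h_int a).comp_snd τ)
        (Finset.measurable_sum _ fun i _ => Measurable.mul (by fun_prop)
          ((measurable_pi_apply i).comp (hZω.comp measurable_fst)))
    rw [Complex.ofReal_sub, shiftedOccupation_eq_fourier hε, shiftedOccupation_eq_fourier hε,
      ← integral_sub (hq a) (hq b)]
    refine integral_congr_ae (Eventually.of_forall fun q => ?_)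
    simp only [Pi.sub_apply, sub_mul]
    rw [← integral_sub] <;> exact integrable_mul_exp_I_mul (h_int _) (by fun_prop)

end

theorem tsum_pi_prod_eq_pow (u : ℤ → ℝ≥0∞) (d : ℕ) :
    ∑' a : Fin d → ℤ, ∏ i, u (a i) = (∑' n, u n) ^ d := by
  induction d with
  | zero => simp
  | succ d ih =>
    rw [← (Fin.consEquiv fun _ : Fin (d + 1) => ℤ).tsum_eq, ENNReal.tsum_prod', pow_succ', ← ih]
    simp only [Fin.consEquiv_apply, Fin.prod_univ_succ, Fin.cons_zero, Fin.cons_succ]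
    simp only [ENNReal.tsum_mul_left, ENNReal.tsum_mul_right]

theorem tsum_inv_one_add_sq_lt_top :
    ∑' n : ℤ, ENNReal.ofReal ((1 + (n : ℝ) ^ 2)⁻¹) < ∞ := by
  have h : Summable fun n : ℤ => (1 + (n : ℝ) ^ 2)⁻¹ := by
    refine Summable.of_norm_bounded_eventually
      (Real.summable_one_div_int_pow.2 one_lt_two) ?_
    filter_upwards [(Set.finite_singleton (0 : ℤ)).compl_mem_cofinite] with n hn
    have hn0 : (n : ℝ) ≠ 0 := by exact_mod_cast hn
    rw [Real.norm_of_nonneg (by positivity), ← one_div]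
    have : 0 < (n : ℝ) ^ 2 := by positivity
    exact one_div_le_one_div_of_le this (by linarith)
  exact h.tsum_ofReal_lt_top

theorem tsum_inv_prod_one_add_sq_lt_top (d : ℕ) :
    ∑' a : Fin d → ℤ, (ENNReal.ofReal (∏ i, (1 + (a i : ℝ) ^ 2)))⁻¹ < ∞ := by
  have h : ∀ a : Fin d → ℤ, (ENNReal.ofReal (∏ i, (1 + (a i : ℝ) ^ 2)))⁻¹
      = ∏ i, ENNReal.ofReal ((1 + (a i : ℝ) ^ 2)⁻¹) := fun a => by
    rw [← ENNReal.ofReal_inv_of_pos (Finset.prod_pos fun i _ => by positivity),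
      ← Finset.prod_inv_distrib, ENNReal.ofReal_prod_of_nonneg fun i _ => by positivity]
  simp_rw [h]
  rw [tsum_pi_prod_eq_pow fun n => ENNReal.ofReal ((1 + (n : ℝ) ^ 2)⁻¹)]
  exact ENNReal.pow_lt_top tsum_inv_one_add_sq_lt_top

/-- A random member of a countable family of functions is controlled by the second moments of
the family and a weight moment of the random index. -/
theorem lintegral_random_index_le {Ω α : Type*} [MeasurableSpace Ω] {P : Measure Ω} [Countable α]
    [MeasurableSpace α] [MeasurableSingletonClass α] {ι : Ω → α} (hι : Measurable ι)
    {h : α → Ω → ℝ≥0∞} (hh : ∀ a, Measurable (h a)) {w : α → ℝ≥0∞} (hw0 : ∀ a, w a ≠ 0)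
    (hw : ∀ a, w a ≠ ∞) {B : ℝ≥0∞} (hB : ∀ a, ∫⁻ ω, h a ω ^ 2 ∂P ≤ B) :
    ∫⁻ ω, h (ι ω) ω ∂P ≤ (∫⁻ ω, w (ι ω) ∂P) ^ (1 / 2 : ℝ) *
      ((∑' a, (w a)⁻¹) * B) ^ (1 / 2 : ℝ) := by
  have hwm : Measurable w := measurable_of_countable w
  have hhι : Measurable fun ω => h (ι ω) ω :=
    (measurable_from_prod_countable_right hh : Measurable fun p : α × Ω => h p.1 p.2).comp
      (hι.prodMk measurable_id)
  have hsq : ∀ x : ℝ≥0∞, (x ^ (1 / 2 : ℝ)) ^ (2 : ℝ) = x := fun x => by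
    rw [← ENNReal.rpow_mul]; norm_num
  have hH := ENNReal.lintegral_mul_le_Lp_mul_Lq P (p := 2) (q := 2)
    (by rw [Real.holderConjugate_iff]; norm_num)
    (f := fun ω => w (ι ω) ^ (1 / 2 : ℝ)) (g := fun ω => (w (ι ω))⁻¹ ^ (1 / 2 : ℝ) * h (ι ω) ω)
    ((hwm.comp hι).pow_const _).aemeasurable
    ((((hwm.comp hι).inv).pow_const _).mul hhι).aemeasurable
  simp only [hsq, ENNReal.mul_rpow_of_nonneg _ _ zero_le_two] at hH
  calc ∫⁻ ω, h (ι ω) ω ∂P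
      = ∫⁻ ω, ((fun ω => w (ι ω) ^ (1 / 2 : ℝ))
          * fun ω => (w (ι ω))⁻¹ ^ (1 / 2 : ℝ) * h (ι ω) ω) ω ∂P := by
        refine lintegral_congr fun ω => ?_
        rw [Pi.mul_apply, ← mul_assoc, ← ENNReal.mul_rpow_of_nonneg _ _ (by norm_num),
          ENNReal.mul_inv_cancel (hw0 _) (hw _), ENNReal.one_rpow, one_mul]
    _ ≤ _ := hH
    _ ≤ _ := by
        refine mul_le_mul' le_rfl (ENNReal.rpow_le_rpow ?_ (by norm_num))
        calc ∫⁻ ω, (w (ι ω))⁻¹ * h (ι ω) ω ^ (2 : ℝ) ∂P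
            ≤ ∫⁻ ω, ∑' a, (w a)⁻¹ * h a ω ^ 2 ∂P := by
              refine lintegral_mono fun ω => ?_
              rw [ENNReal.rpow_two]
              exact ENNReal.le_tsum (f := fun a => (w a)⁻¹ * h a ω ^ 2) (ι ω)
          _ = ∑' a, (w a)⁻¹ * ∫⁻ ω, h a ω ^ 2 ∂P := by
              rw [lintegral_tsum fun a => (((hh a).pow_const _).const_mul _).aemeasurable]
              exact tsum_congr fun a => lintegral_const_mul _ ((hh a).pow_const _)
          _ ≤ ∑' a, (w a)⁻¹ * B := ENNReal.tsum_le_tsum fun a => mul_le_mul' le_rfl (hB a)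
          _ = _ := ENNReal.tsum_mul_right

/-- Geometrically decaying `m`-th moments give a finite `m`-th moment of the sum. -/
theorem exists_lintegral_tsum_pow_le {Ω : Type*} [MeasurableSpace Ω] (P : Measure Ω) {m : ℕ}
    (hm : m ≠ 0) {ρ : ℝ} (hρ0 : 0 < ρ) (hρ : ρ < 1) :
    ∃ c : ℝ≥0∞, c < ∞ ∧ ∀ (x : ℕ → Ω → ℝ≥0∞) (K : ℝ≥0∞), (∀ n, Measurable (x n)) →
      (∀ n, ∫⁻ ω, x n ω ^ m ∂P ≤ K * ENNReal.ofReal (ρ ^ n)) →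
      ∫⁻ ω, (∑' n, x n ω) ^ m ∂P ≤ c * K := by
  set l : ℝ := ρ ^ (1 / (2 * m : ℝ)) with hl
  have hl0 : 0 < l := Real.rpow_pos_of_pos hρ0 _
  have hl1 : l < 1 := Real.rpow_lt_one hρ0.le hρ (by positivity)
  have hlm : (l ^ m) ^ 2 = ρ := by
    rw [← pow_mul, hl, ← Real.rpow_mul_natCast hρ0.le]
    have : (1 / (2 * m : ℝ)) * ((m * 2 : ℕ) : ℝ) = 1 := by push_cast; field_simp
    rw [this, Real.rpow_one]
  set L : ℝ≥0∞ := ENNReal.ofReal l with hL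
  have hL0 : L ≠ 0 := by simpa [hL] using hl0
  have hLt : L ≠ ∞ := ENNReal.ofReal_ne_top
  have hL1 : L < 1 := by rw [hL]; exact ENNReal.ofReal_lt_one.2 hl1
  have hgeom : ∀ r : ℝ≥0∞, r < 1 → ∑' n : ℕ, r ^ n < ∞ := fun r hr => by
    rw [ENNReal.tsum_geometric]
    exact ENNReal.inv_lt_top.2 (tsub_pos_of_lt hr)
  have hLm : L ^ m < 1 := pow_lt_one₀ zero_le hL1 hm
  refine ⟨(∑' n : ℕ, L ^ n) ^ m * ∑' n : ℕ, (L ^ m) ^ n,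
    ENNReal.mul_lt_top (ENNReal.pow_lt_top (hgeom L hL1)) (hgeom _ hLm), fun x K hx hK => ?_⟩
  have hpt : ∀ ω, (∑' n, x n ω) ^ m
      ≤ (∑' n : ℕ, L ^ n) ^ m * ∑' n, ((L ^ n)⁻¹ * x n ω) ^ m := by
    intro ω
    set Y := ∑' n, ((L ^ n)⁻¹ * x n ω) ^ m with hY
    have h1 : ∀ n, x n ω ≤ L ^ n * Y ^ (1 / (m : ℝ)) := by
      intro n
      have h2 : (L ^ n)⁻¹ * x n ω ≤ Y ^ (1 / (m : ℝ)) := by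
        rw [one_div, ENNReal.le_rpow_inv_iff (by positivity), ENNReal.rpow_natCast]
        exact ENNReal.le_tsum (f := fun n => ((L ^ n)⁻¹ * x n ω) ^ m) n
      calc x n ω = L ^ n * ((L ^ n)⁻¹ * x n ω) := by
            rw [← mul_assoc, ENNReal.mul_inv_cancel (pow_ne_zero _ hL0)
              (ENNReal.pow_ne_top hLt), one_mul]
        _ ≤ _ := mul_le_mul' le_rfl h2
    calc (∑' n, x n ω) ^ m ≤ (∑' n : ℕ, L ^ n * Y ^ (1 / (m : ℝ))) ^ m := by
          gcongr; exact h1 _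
      _ = _ := by
          rw [ENNReal.tsum_mul_right, mul_pow, ← ENNReal.rpow_natCast (Y ^ (1 / (m : ℝ))),
            ← ENNReal.rpow_mul, one_div_mul_cancel (by positivity), ENNReal.rpow_one]
  calc _ ≤ ∫⁻ ω, (∑' n : ℕ, L ^ n) ^ m * ∑' n, ((L ^ n)⁻¹ * x n ω) ^ m ∂P := lintegral_mono hpt
    _ = (∑' n : ℕ, L ^ n) ^ m * ∑' n, ((L ^ n)⁻¹) ^ m * ∫⁻ ω, x n ω ^ m ∂P := by
        rw [lintegral_const_mul, lintegral_tsum]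
        · congr 1
          refine tsum_congr fun n => ?_
          simp_rw [mul_pow]
          exact lintegral_const_mul _ ((hx n).pow_const _)
        · exact fun n => (((hx n).const_mul _).pow_const _).aemeasurable
        · exact Measurable.tsum fun n => ((hx n).const_mul _).pow_const _
    _ ≤ (∑' n : ℕ, L ^ n) ^ m * ∑' n : ℕ, (L ^ m) ^ n * K := by
        refine mul_le_mul' le_rfl (ENNReal.tsum_le_tsum fun n => ?_)
        refine (mul_le_mul' le_rfl (hK n)).trans_eq ?_
        have h3 : ENNReal.ofReal (ρ ^ n) = (L ^ n) ^ m * (L ^ m) ^ n := by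
          rw [← hlm, hL, ← ENNReal.ofReal_pow hl0.le, ← ENNReal.ofReal_pow (by positivity),
            ← ENNReal.ofReal_pow hl0.le, ← ENNReal.ofReal_pow (by positivity),
            ← ENNReal.ofReal_mul (by positivity)]
          congr 1; ring
        rw [h3, ← ENNReal.inv_pow, mul_left_comm, ← mul_assoc ((L ^ n) ^ m)⁻¹,
          ENNReal.inv_mul_cancel (pow_ne_zero _ (pow_ne_zero _ hL0))
            (ENNReal.pow_ne_top (ENNReal.pow_ne_top hLt)), one_mul, mul_comm]
    _ = _ := by rw [ENNReal.tsum_mul_right, mul_assoc]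

/-- The index of the dyadic cube of side `2⁻ⁿ` containing `z`. -/
def dyadicFloor {d : ℕ} (n : ℕ) (z : Fin d → ℝ) : Fin d → ℤ := fun i => ⌊2 ^ n * z i⌋

/-- The point of the dyadic lattice of mesh `2⁻ⁿ` with index `a`. -/
def dyadicPoint {d : ℕ} (n : ℕ) (a : Fin d → ℤ) : Fin d → ℝ := fun i => a i / 2 ^ n

theorem measurable_dyadicFloor {d : ℕ} (n : ℕ) : Measurable (dyadicFloor (d := d) n) :=
  measurable_pi_lambda _ fun i => Int.measurable_floor.comp
    ((measurable_pi_apply i).const_mul _)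

theorem dyadicFloor_eq_half {d : ℕ} (n : ℕ) (z : Fin d → ℝ) :
    dyadicFloor n z = fun i => dyadicFloor (n + 1) z i / 2 := by
  ext i
  have h := Int.floor_div_natCast (2 ^ (n + 1) * z i) 2
  rw [show (2 ^ (n + 1) * z i / (2 : ℕ) : ℝ) = 2 ^ n * z i by push_cast; ring] at h
  exact h

theorem norm_dyadicPoint_succ_sub_le {d : ℕ} (n : ℕ) (a : Fin d → ℤ) :
    ‖dyadicPoint (n + 1) a - dyadicPoint n (fun i => a i / 2)‖ ≤ (1 / 2) ^ (n + 1) := by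
  refine (pi_norm_le_iff_of_nonneg (by positivity)).2 fun i => ?_
  have h : (a i : ℝ) = 2 * ((a i / 2 : ℤ) : ℝ) + ((a i % 2 : ℤ) : ℝ) := by
    exact_mod_cast (Int.mul_ediv_add_emod (a i) 2).symm
  have h0 : (0 : ℝ) ≤ ((a i % 2 : ℤ) : ℝ) := by
    exact_mod_cast Int.emod_nonneg _ two_ne_zero
  have h1 : ((a i % 2 : ℤ) : ℝ) ≤ 1 := by
    have := Int.emod_lt_of_pos (a i) two_pos
    exact_mod_cast Int.lt_add_one_iff.1 this
  have h2 : (dyadicPoint (n + 1) a - dyadicPoint n (fun i => a i / 2)) i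
      = ((a i % 2 : ℤ) : ℝ) * (1 / 2) ^ (n + 1) := by
    simp only [dyadicPoint, Pi.sub_apply]
    rw [h, one_div, inv_pow, pow_succ]
    field_simp
    ring
  rw [h2, Real.norm_of_nonneg (by positivity)]
  exact mul_le_of_le_one_left (by positivity) h1

theorem tendsto_dyadicPoint_dyadicFloor {d : ℕ} (z : Fin d → ℝ) :
    Tendsto (fun n => dyadicPoint n (dyadicFloor n z)) atTop (𝓝 z) := by
  refine tendsto_pi_nhds.2 fun i => ?_
  have h0 : Tendsto (fun n : ℕ => z i - (1 / 2 : ℝ) ^ n) atTop (𝓝 (z i)) := by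
    simpa using (tendsto_pow_atTop_nhds_zero_of_lt_one (by norm_num : (0 : ℝ) ≤ 1 / 2)
      (by norm_num)).const_sub (z i)
  refine tendsto_of_tendsto_of_tendsto_of_le_of_le h0 tendsto_const_nhds (fun n => ?_) fun n => ?_
  · have := Int.lt_floor_add_one (2 ^ n * z i)
    simp only [dyadicPoint, dyadicFloor]
    rw [le_div_iff₀ (by positivity), sub_mul, ← mul_pow]
    norm_num
    linarith
  · have := Int.floor_le (2 ^ n * z i)
    simp only [dyadicPoint, dyadicFloor]
    rw [div_le_iff₀ (by positivity)]
    linarith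

theorem prod_one_add_dyadicFloor_sq_le {d : ℕ} (n : ℕ) (z : Fin d → ℝ) :
    ∏ i, (1 + (dyadicFloor n z i : ℝ) ^ 2) ≤ (2 ^ (n * d)) ^ 2 * ∏ i, (3 + 2 * z i ^ 2) := by
  have h : ((2 : ℝ) ^ (n * d)) ^ 2 = ∏ _i : Fin d, (2 ^ n) ^ 2 := by
    rw [Finset.prod_const, Finset.card_univ, Fintype.card_fin, pow_mul, ← pow_mul, ← pow_mul,
      mul_comm d 2, pow_mul, pow_mul _ 2 d]
  rw [h, ← Finset.prod_mul_distrib]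
  refine Finset.prod_le_prod (fun i _ => by positivity) fun i _ => ?_
  have h1 := Int.lt_floor_add_one (2 ^ n * z i)
  have h2 := Int.floor_le (2 ^ n * z i)
  have h3 : (1 : ℝ) ≤ 2 ^ n := one_le_pow₀ one_le_two
  simp only [dyadicFloor]
  set u : ℝ := (⌊2 ^ n * z i⌋ : ℝ)
  set v : ℝ := 2 ^ n * z i with hv
  have h4 : u ^ 2 ≤ 2 * v ^ 2 + 2 := by nlinarith [sq_nonneg (u - 2 * v), sq_nonneg (v - u)]
  calc 1 + u ^ 2 ≤ 3 * 1 + 2 * v ^ 2 := by linarith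
    _ ≤ 3 * (2 ^ n) ^ 2 + 2 * v ^ 2 := by
        gcongr; exact one_le_pow₀ h3
    _ = _ := by rw [hv]; ring

theorem exists_lintegral_comp_random_point_le {Ω : Type*} [MeasurableSpace Ω] {P : Measure Ω}
    {d : ℕ} {N : Ω → Fin d → ℝ} (hN : Measurable N)
    (hNmom : ∫⁻ ω, ENNReal.ofReal (∏ i, (3 + 2 * N ω i ^ 2)) ∂P < ∞) {δ : ℝ}
    {m : ℕ} (hm : m ≠ 0) (hdm : d < δ * m) {C : ℝ≥0∞} (hC : C < ∞) :
    ∃ C' : ℝ≥0∞, C' < ∞ ∧ ∀ f : (Fin d → ℝ) → Ω → ℝ,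
      (Measurable fun p : (Fin d → ℝ) × Ω => f p.1 p.2) → (∀ ω, Continuous fun a => f a ω) →
      (∀ a, ∫⁻ ω, ‖f a ω‖ₑ ^ (2 * m) ∂P ≤ C) →
      (∀ a b, ∫⁻ ω, ‖f a ω - f b ω‖ₑ ^ (2 * m) ∂P
        ≤ ENNReal.ofReal ((2 * ‖a - b‖ ^ δ) ^ (2 * m)) * C) →
      ∫⁻ ω, ‖f (N ω) ω‖ₑ ^ m ∂P ≤ C' := by
  have hδ : 0 < δ := by
    have h1 : (0 : ℝ) < m := by positivity
    have h2 : (0 : ℝ) ≤ d := by positivity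
    exact pos_of_mul_pos_left (h2.trans_lt hdm) h1.le
  set q : ℝ := (1 / 2) ^ δ with hq
  have hq0 : 0 < q := by positivity
  set ρ : ℝ := 2 ^ d * q ^ m with hρ
  have hρ0 : 0 < ρ := by positivity
  have hρ1 : ρ < 1 := by
    have : ρ = 2 ^ ((d : ℝ) - δ * m) := by
      rw [hρ, hq, one_div, Real.inv_rpow zero_le_two, ← Real.rpow_neg zero_le_two,
        ← Real.rpow_mul_natCast zero_le_two, ← Real.rpow_natCast, ← Real.rpow_add two_pos]
      congr 1; ring
    rw [this]
    exact Real.rpow_lt_one_of_one_lt_of_neg one_lt_two (by linarith)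
  obtain ⟨c, hc, hsum⟩ := exists_lintegral_tsum_pow_le P hm hρ0 hρ1
  set E := ∫⁻ ω, ENNReal.ofReal (∏ i, (3 + 2 * N ω i ^ 2)) ∂P with hE
  set S := ∑' a : Fin d → ℤ, (ENNReal.ofReal (∏ i, (1 + (a i : ℝ) ^ 2)))⁻¹ with hS
  set K := ENNReal.ofReal (2 ^ m) * (E ^ (1 / 2 : ℝ) * (S ^ (1 / 2 : ℝ) * C ^ (1 / 2 : ℝ))) with hK
  have hfin : ∀ x : ℝ≥0∞, x < ∞ → x ^ (1 / 2 : ℝ) < ∞ := fun x hx =>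
    ENNReal.rpow_lt_top_of_nonneg (by norm_num) hx.ne
  have hKt : K < ∞ := ENNReal.mul_lt_top ENNReal.ofReal_lt_top
    (ENNReal.mul_lt_top (hfin _ hNmom)
      (ENNReal.mul_lt_top (hfin _ (tsum_inv_prod_one_add_sq_lt_top d)) (hfin _ hC)))
  refine ⟨c * K, ENNReal.mul_lt_top hc hKt, fun f hf hcont hf0 hf1 => ?_⟩
  set g : ℕ → (Fin d → ℤ) → Ω → ℝ := fun n a ω => match n with
    | 0 => f (dyadicPoint 0 a) ω
    | n + 1 => f (dyadicPoint (n + 1) a) ω - f (dyadicPoint n (fun i => a i / 2)) ω with hg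
  have hfm : ∀ a, Measurable (f a) := fun a => hf.comp (measurable_const.prodMk measurable_id)
  have hgm : ∀ n a, Measurable (g n a) := by
    rintro (_ | n) a
    · exact hfm _
    · exact (hfm _).sub (hfm _)
  have hgmom : ∀ n a, ∫⁻ ω, (‖g n a ω‖ₑ ^ m) ^ 2 ∂P
      ≤ (ENNReal.ofReal ((2 * q ^ n) ^ m)) ^ 2 * C := by
    intro n a
    simp_rw [← pow_mul, mul_comm m 2]
    rw [← ENNReal.ofReal_pow (by positivity), ← pow_mul, mul_comm m 2]
    rcases n with _ | n
    · refine (hf0 _).trans (le_mul_of_one_le_left zero_le ?_)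
      rw [ENNReal.one_le_ofReal]
      simpa using one_le_pow₀ (one_le_two (α := ℝ))
    · refine (hf1 _ _).trans ?_
      gcongr
      rw [hq, ← Real.rpow_mul_natCast (by norm_num), mul_comm δ,
          Real.rpow_natCast_mul (by norm_num)]
      exact Real.rpow_le_rpow (norm_nonneg _) (norm_dyadicPoint_succ_sub_le n a) hδ.le
  set x : ℕ → Ω → ℝ≥0∞ := fun n ω => ‖g n (dyadicFloor n (N ω)) ω‖ₑ with hx
  have hxm : ∀ n, Measurable (x n) := fun n =>
    ((measurable_from_prod_countable_right (hgm n) :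
      Measurable fun p : (Fin d → ℤ) × Ω => g n p.1 p.2).comp
      (((measurable_dyadicFloor n).comp hN).prodMk measurable_id)).enorm
  have hxK : ∀ n, ∫⁻ ω, x n ω ^ m ∂P ≤ K * ENNReal.ofReal (ρ ^ n) := by
    intro n
    have h := lintegral_random_index_le (P := P) ((measurable_dyadicFloor n).comp hN)
      (h := fun a ω => ‖g n a ω‖ₑ ^ m) (fun a => (hgm n a).enorm.pow_const _)
      (w := fun a => ENNReal.ofReal (∏ i, (1 + (a i : ℝ) ^ 2)))
      (fun a => by
        have : 0 < ∏ i, (1 + (a i : ℝ) ^ 2) := Finset.prod_pos fun i _ => by positivity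
        simpa using this) (fun a => ENNReal.ofReal_ne_top) (hgmom n)
    have hsq : ∀ x : ℝ≥0∞, (x ^ 2) ^ (1 / 2 : ℝ) = x := fun x => by
      rw [← ENNReal.rpow_natCast, ← ENNReal.rpow_mul]; norm_num
    refine h.trans ?_
    have hW : ∫⁻ ω, ENNReal.ofReal (∏ i, (1 + ((dyadicFloor n ∘ N) ω i : ℝ) ^ 2)) ∂P
        ≤ (ENNReal.ofReal (2 ^ (n * d))) ^ 2 * E := by
      rw [hE, ← lintegral_const_mul _ (by fun_prop)]
      refine lintegral_mono fun ω => ?_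
      rw [← ENNReal.ofReal_pow (by positivity), ← ENNReal.ofReal_mul (by positivity)]
      exact ENNReal.ofReal_le_ofReal (prod_one_add_dyadicFloor_sq_le n (N ω))
    refine (mul_le_mul' (ENNReal.rpow_le_rpow hW (by norm_num)) le_rfl).trans_eq ?_
    have hr : ENNReal.ofReal (2 ^ (n * d)) * ENNReal.ofReal ((2 * q ^ n) ^ m)
        = ENNReal.ofReal (2 ^ m) * ENNReal.ofReal (ρ ^ n) := by
      rw [← ENNReal.ofReal_mul (by positivity), ← ENNReal.ofReal_mul (by positivity)]
      congr 1
      rw [hρ, mul_pow, mul_pow, ← pow_mul, ← pow_mul, ← pow_mul, mul_comm n d, mul_comm n m]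
      ring
    simp only [ENNReal.mul_rpow_of_nonneg _ _ (by norm_num : (0 : ℝ) ≤ 1 / 2), hsq]
    rw [hK]
    calc _ = (ENNReal.ofReal (2 ^ (n * d)) * ENNReal.ofReal ((2 * q ^ n) ^ m))
          * (E ^ (1 / 2 : ℝ) * (S ^ (1 / 2 : ℝ) * C ^ (1 / 2 : ℝ))) := by ring
      _ = _ := by rw [hr]; ring
  refine (lintegral_mono fun ω => ?_).trans (hsum x K hxm hxK)
  gcongr
  have hlim := ((hcont ω).tendsto (N ω)).comp (tendsto_dyadicPoint_dyadicFloor (N ω))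
  refine le_of_tendsto hlim.enorm (Eventually.of_forall fun n => ?_)
  refine le_trans ?_ (ENNReal.sum_le_tsum (Finset.range (n + 1)))
  induction n with
  | zero => simp [hx, hg]
  | succ n ih =>
    rw [Finset.sum_range_succ]
    refine le_trans ?_ (add_le_add_left ih _)
    have : g (n + 1) (dyadicFloor (n + 1) (N ω)) ω
        = f (dyadicPoint (n + 1) (dyadicFloor (n + 1) (N ω))) ω
          - f (dyadicPoint n (dyadicFloor n (N ω))) ω := by
      rw [dyadicFloor_eq_half n]
    simp only [hx, this, Function.comp_apply]
    refine le_trans (le_of_eq ?_) (enorm_add_le _ _)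
    congr 1; ring

theorem lintegral_momentKernel_incrementDiff_lt_top
    {d : ℕ} {H₁ H₂ : ℝ} (hH₁ : 0 < H₁) (hH₂ : 0 < H₂)
    {Ω : Type*} [MeasurableSpace Ω] {P : Measure Ω} [IsProbabilityMeasure P]
    {X Xt : ℝ → Ω → Fin d → ℝ}
    (hXmeas : Measurable fun q : ℝ × Ω => X q.1 q.2)
    (hXtmeas : Measurable fun q : ℝ × Ω => Xt q.1 q.2)
    -- (a) Gaussianity of the linear combinations
    (hGauss : ∀ (m : ℕ) (s t : Fin m → ℝ), (∀ j, 0 ≤ s j) → (∀ j, 0 ≤ t j) →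
      ∀ y : Fin m → Fin d → ℝ,
      Measure.map (fun ω => ∑ j, ∑ i, y j i * (X (s j) ω i - Xt (t j) ω i)) P
        = gaussianReal 0
            (Real.toNNReal
              (variance (fun ω => ∑ j, ∑ i, y j i * (X (s j) ω i - Xt (t j) ω i)) P)))
    -- (b) variance splitting between the two independent processes
    (hVarSplit : ∀ (m : ℕ) (s t : Fin m → ℝ), (∀ j, 0 ≤ s j) → (∀ j, 0 ≤ t j) →
      ∀ y : Fin m → Fin d → ℝ,
      variance (fun ω => ∑ j, ∑ i, y j i * (X (s j) ω i - Xt (t j) ω i)) P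
        = variance (fun ω => ∑ j, ∑ i, y j i * X (s j) ω i) P
          + variance (fun ω => ∑ j, ∑ i, y j i * Xt (t j) ω i) P)
    -- (b) variance splitting across coordinates
    (hVarCoordX : ∀ (m : ℕ) (s : Fin m → ℝ), (∀ j, 0 ≤ s j) →
      ∀ y : Fin m → Fin d → ℝ,
      variance (fun ω => ∑ j, ∑ i, y j i * X (s j) ω i) P
        = ∑ i, variance (fun ω => ∑ j, y j i * X (s j) ω i) P)
    (hVarCoordXt : ∀ (m : ℕ) (t : Fin m → ℝ), (∀ j, 0 ≤ t j) →
      ∀ y : Fin m → Fin d → ℝ,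
      variance (fun ω => ∑ j, ∑ i, y j i * Xt (t j) ω i) P
        = ∑ i, variance (fun ω => ∑ j, y j i * Xt (t j) ω i) P)
    -- (c) local nondeterminism of X with exponent 2H₁
    (hLNDX : ∀ T : ℝ, 0 < T → ∀ m : ℕ, 1 ≤ m → ∃ κ : ℝ, 0 < κ ∧
      ∀ s : ℕ → ℝ, s 0 = 0 → (∀ j, j < m → s j < s (j + 1)) → s m < 2 * T →
        ∀ x : Fin m → ℝ, ∀ i : Fin d,
        κ * ∑ j : Fin m, (x j) ^ 2 * (s ((j : ℕ) + 1) - s (j : ℕ)) ^ (2 * H₁)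
          ≤ variance
              (fun ω => ∑ j : Fin m, x j * (X (s ((j : ℕ) + 1)) ω i - X (s (j : ℕ)) ω i)) P)
    -- (c) local nondeterminism of X̃ with exponent 2H₂
    (hLNDXt : ∀ T : ℝ, 0 < T → ∀ m : ℕ, 1 ≤ m → ∃ κ : ℝ, 0 < κ ∧
      ∀ t : ℕ → ℝ, t 0 = 0 → (∀ j, j < m → t j < t (j + 1)) → t m < 2 * T →
        ∀ x : Fin m → ℝ, ∀ i : Fin d,
        κ * ∑ j : Fin m, (x j) ^ 2 * (t ((j : ℕ) + 1) - t (j : ℕ)) ^ (2 * H₂)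
          ≤ variance
              (fun ω => ∑ j : Fin m, x j * (Xt (t ((j : ℕ) + 1)) ω i - Xt (t (j : ℕ)) ω i)) P)
    {T : ℝ} (hT : 0 < T) {M : ℕ} (hM : 1 ≤ M) {κ : Fin d → ℝ} (hκ : ∀ i, 0 ≤ κ i)
    (hlt : H₁ * H₂ / (H₁ + H₂) * (2 * ∑ i, κ i + d) < 1) :
    ∫⁻ z, momentKernel P κ (incrementDiff X Xt) z ∂(Measure.pi fun _ : Fin M =>
      ((volume.restrict (Set.Icc 0 T)).prod (volume.restrict (Set.Icc 0 T))).prod volume) < ∞ := by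
  obtain ⟨c₁, hc₁, h₁⟩ := hLNDX T hT M hM
  obtain ⟨c₂, hc₂, h₂⟩ := hLNDXt T hT M hM
  refine lintegral_lt_top_of_sortedEnergy_bound hH₁ hH₂ hc₁ hc₂ hT hκ hlt
    (measurable_momentKernel κ (measurable_incrementDiff hXmeas hXtmeas))
    fun s t y hs ht hsT htT => ?_
  rw [momentKernel, ← ofReal_norm, ← ENNReal.ofReal_mul
    (Finset.prod_nonneg fun _ _ => polyWeight_nonneg _ _)]
  refine ENNReal.ofReal_le_ofReal (mul_le_mul_of_nonneg_left ?_
    (Finset.prod_nonneg fun _ _ => polyWeight_nonneg _ _))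
  exact norm_integral_exp_incrementDiff_le hXmeas hXtmeas hGauss hVarSplit hVarCoordX hVarCoordXt
    (fun j => (hsT j).1.le) (fun j => (htT j).1.le) y
    (sortedEnergy_le_sum_variance hT h₁ hs hsT y) (sortedEnergy_le_sum_variance hT h₂ ht htT y)

theorem integrable_three_add_two_mul_sq_pow_gaussianReal (v : NNReal) (n : ℕ) :
    Integrable (fun x : ℝ => (3 + 2 * x ^ 2) ^ n) (gaussianReal 0 v) := by
  simp only [add_pow, mul_pow, ← pow_mul]
  refine integrable_finsetSum _ fun j _ => ?_
  refine Integrable.mul_const (Integrable.const_mul (Integrable.const_mul ?_ _) _) _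
  have h := (memLp_id_gaussianReal' (μ := 0) (v := v) (2 * (n - j) : ℕ)
    (ENNReal.natCast_ne_top _)).integrable_norm_pow'
  refine h.congr (Eventually.of_forall fun x => ?_)
  simp [pow_mul]

theorem prod_le_sum_pow_card {ι : Type*} [Fintype ι] [Nonempty ι] {a : ι → ℝ}
    (ha : ∀ i, 0 ≤ a i) : ∏ i, a i ≤ ∑ i, a i ^ Fintype.card ι := by
  obtain ⟨j, -, hj⟩ := Finset.exists_max_image Finset.univ a Finset.univ_nonempty
  calc ∏ i, a i ≤ ∏ _i : ι, a j := Finset.prod_le_prod (fun i _ => ha i) hj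
    _ = a j ^ Fintype.card ι := by simp
    _ ≤ _ := Finset.single_le_sum (f := fun i => a i ^ Fintype.card ι)
      (fun i _ => pow_nonneg (ha i) _) (Finset.mem_univ j)

theorem lintegral_prod_three_add_two_mul_sq_lt_top {d : ℕ} (hd : 1 ≤ d) {Ω : Type*}
    [MeasurableSpace Ω] {P : Measure Ω} {N : Ω → Fin d → ℝ} (hN : Measurable N)
    (hgauss : ∀ i, ∃ v, P.map (fun ω => N ω i) = gaussianReal 0 v) :
    ∫⁻ ω, ENNReal.ofReal (∏ i, (3 + 2 * N ω i ^ 2)) ∂P < ∞ := by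
  have : Nonempty (Fin d) := ⟨⟨0, hd⟩⟩
  have h_int : Integrable (fun ω => ∑ i, (3 + 2 * N ω i ^ 2) ^ Fintype.card (Fin d)) P := by
    refine integrable_finsetSum _ fun i _ => ?_
    obtain ⟨v, hv⟩ := hgauss i
    have h := integrable_three_add_two_mul_sq_pow_gaussianReal v (Fintype.card (Fin d))
    rw [← hv] at h
    exact h.comp_measurable ((measurable_pi_apply i).comp hN)
  refine lt_of_le_of_lt (lintegral_mono fun ω => ENNReal.ofReal_le_ofReal
    (prod_le_sum_pow_card fun i => by positivity)) ?_
  exact h_int.lintegral_lt_top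

theorem exists_pos_le_one_mul_add_lt {A B c : ℝ} (hA : 0 ≤ A) (h : B < c) :
    ∃ δ : ℝ, 0 < δ ∧ δ ≤ 1 ∧ A * δ + B < c := by
  have h1 : 0 < (c - B) / (A + 1) := div_pos (by linarith) (by linarith)
  refine ⟨min 1 ((c - B) / (A + 1)), lt_min one_pos h1, min_le_left _ _, ?_⟩
  have h2 := min_le_right 1 ((c - B) / (A + 1))
  have h3 : 0 < min 1 ((c - B) / (A + 1)) := lt_min one_pos h1
  rw [le_div_iff₀ (by linarith)] at h2
  nlinarith

theorem locTimeApprox_eq_shiftedOccupation {d : ℕ} {Ω : Type*} [MeasurableSpace Ω]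
    {X Xt : ℝ → Ω → Fin d → ℝ} (hX : Measurable fun q : ℝ × Ω => X q.1 q.2)
    (hXt : Measurable fun q : ℝ × Ω => Xt q.1 q.2) (k : Fin d → ℕ) {ε : ℝ} (hε : 0 < ε) (T : ℝ)
    (x : Fin d → ℝ) (ω : Ω) :
    locTimeApprox d X Xt k ε T x ω = shiftedOccupation k ε
      ((volume.restrict (Set.Icc 0 T)).prod (volume.restrict (Set.Icc 0 T)))
      (incrementDiff X Xt) ((X 0 ω - Xt 0 ω) - x) ω := by
  rw [shiftedOccupation, integral_prod _
    (integrable_heatKernelDeriv_comp hε (measurable_incrementDiff hX hXt) _ _), locTimeApprox]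
  refine integral_congr_ae (Eventually.of_forall fun t =>
    integral_congr_ae (Eventually.of_forall fun s => ?_))
  refine congrArg (heatKernelDeriv d k ε) (funext fun i => ?_)
  simp only [incrementDiff, Pi.add_apply, Pi.sub_apply]
  ring

theorem integral_abs_pow_le_of_lintegral_enorm_pow_le {Ω : Type*} [MeasurableSpace Ω]
    {P : Measure Ω} [IsProbabilityMeasure P] {f : Ω → ℝ} (hf : Measurable f) {m n : ℕ}
    (hmn : m ≤ n) {C : ℝ≥0∞} (hC : C < ∞) (h : ∫⁻ ω, ‖f ω‖ₑ ^ n ∂P ≤ C) :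
    ∫ ω, |f ω| ^ m ∂P ≤ (1 + C).toReal := by
  rw [integral_eq_lintegral_of_nonneg_ae (Eventually.of_forall fun ω => by positivity)
    (by fun_prop)]
  refine ENNReal.toReal_mono (ENNReal.add_lt_top.2 ⟨ENNReal.one_lt_top, hC⟩).ne ?_
  calc ∫⁻ ω, ENNReal.ofReal (|f ω| ^ m) ∂P ≤ ∫⁻ ω, (1 + ‖f ω‖ₑ ^ n) ∂P := by
        refine lintegral_mono fun ω => ?_
        rw [ENNReal.ofReal_pow (abs_nonneg _), ← Real.norm_eq_abs, ofReal_norm]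
        rcases le_total ‖f ω‖ₑ 1 with h1 | h1
        · exact (pow_le_one₀ zero_le h1).trans le_self_add
        · exact (pow_le_pow_right₀ h1 hmn).trans le_add_self
    _ = 1 + ∫⁻ ω, ‖f ω‖ₑ ^ n ∂P := by
        rw [lintegral_add_left measurable_const, lintegral_const, measure_univ, mul_one]
    _ ≤ _ := by gcongr

theorem stmt6
    (d : ℕ) (hd : 1 ≤ d) (H₁ H₂ : ℝ)
    (hH₁ : H₁ ∈ Set.Ioo (0 : ℝ) 1) (hH₂ : H₂ ∈ Set.Ioo (0 : ℝ) 1)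
    {Ω : Type*} [MeasurableSpace Ω] (P : Measure Ω) [IsProbabilityMeasure P]
    (X Xt : ℝ → Ω → Fin d → ℝ)
    (hXmeas : Measurable fun q : ℝ × Ω => X q.1 q.2)
    (hXtmeas : Measurable fun q : ℝ × Ω => Xt q.1 q.2)
    -- (a) Gaussianity of the linear combinations
    (hGauss : ∀ (m : ℕ) (s t : Fin m → ℝ), (∀ j, 0 ≤ s j) → (∀ j, 0 ≤ t j) →
      ∀ y : Fin m → Fin d → ℝ,
      Measure.map (fun ω => ∑ j, ∑ i, y j i * (X (s j) ω i - Xt (t j) ω i)) P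
        = gaussianReal 0
            (Real.toNNReal
              (variance (fun ω => ∑ j, ∑ i, y j i * (X (s j) ω i - Xt (t j) ω i)) P)))
    -- (b) variance splitting between the two independent processes
    (hVarSplit : ∀ (m : ℕ) (s t : Fin m → ℝ), (∀ j, 0 ≤ s j) → (∀ j, 0 ≤ t j) →
      ∀ y : Fin m → Fin d → ℝ,
      variance (fun ω => ∑ j, ∑ i, y j i * (X (s j) ω i - Xt (t j) ω i)) P
        = variance (fun ω => ∑ j, ∑ i, y j i * X (s j) ω i) P
          + variance (fun ω => ∑ j, ∑ i, y j i * Xt (t j) ω i) P)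
    -- (b) variance splitting across coordinates
    (hVarCoordX : ∀ (m : ℕ) (s : Fin m → ℝ), (∀ j, 0 ≤ s j) →
      ∀ y : Fin m → Fin d → ℝ,
      variance (fun ω => ∑ j, ∑ i, y j i * X (s j) ω i) P
        = ∑ i, variance (fun ω => ∑ j, y j i * X (s j) ω i) P)
    (hVarCoordXt : ∀ (m : ℕ) (t : Fin m → ℝ), (∀ j, 0 ≤ t j) →
      ∀ y : Fin m → Fin d → ℝ,
      variance (fun ω => ∑ j, ∑ i, y j i * Xt (t j) ω i) P
        = ∑ i, variance (fun ω => ∑ j, y j i * Xt (t j) ω i) P)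
    -- (c) local nondeterminism of X with exponent 2H₁
    (hLNDX : ∀ T : ℝ, 0 < T → ∀ m : ℕ, 1 ≤ m → ∃ κ : ℝ, 0 < κ ∧
      ∀ s : ℕ → ℝ, s 0 = 0 → (∀ j, j < m → s j < s (j + 1)) → s m < 2 * T →
        ∀ x : Fin m → ℝ, ∀ i : Fin d,
        κ * ∑ j : Fin m, (x j) ^ 2 * (s ((j : ℕ) + 1) - s (j : ℕ)) ^ (2 * H₁)
          ≤ variance
              (fun ω => ∑ j : Fin m, x j * (X (s ((j : ℕ) + 1)) ω i - X (s (j : ℕ)) ω i)) P)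
    -- (c) local nondeterminism of X̃ with exponent 2H₂
    (hLNDXt : ∀ T : ℝ, 0 < T → ∀ m : ℕ, 1 ≤ m → ∃ κ : ℝ, 0 < κ ∧
      ∀ t : ℕ → ℝ, t 0 = 0 → (∀ j, j < m → t j < t (j + 1)) → t m < 2 * T →
        ∀ x : Fin m → ℝ, ∀ i : Fin d,
        κ * ∑ j : Fin m, (x j) ^ 2 * (t ((j : ℕ) + 1) - t (j : ℕ)) ^ (2 * H₂)
          ≤ variance
              (fun ω => ∑ j : Fin m, x j * (Xt (t ((j : ℕ) + 1)) ω i - Xt (t (j : ℕ)) ω i)) P)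
    (k : Fin d → ℕ)
    (hcond : H₁ * H₂ / (H₁ + H₂) * (2 * (∑ i, (k i : ℝ)) + d) < 1) :
    ∀ T : ℝ, 0 < T → ∀ m : ℕ, Even m → 2 ≤ m →
      ∃ C : ℝ, 0 < C ∧ ∀ ε : ℝ, 0 < ε → ∀ x : Fin d → ℝ,
        ∫ ω, |locTimeApprox d X Xt k ε T x ω| ^ (m : ℝ) ∂P ≤ C := by
  intro T hT m _ hm
  obtain ⟨δ, hδ, hδ1, hlt⟩ := exists_pos_le_one_mul_add_lt
    (A := H₁ * H₂ / (H₁ + H₂) * (2 * d))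
    (mul_nonneg (div_nonneg (mul_pos hH₁.1 hH₂.1).le (add_pos hH₁.1 hH₂.1).le) (by positivity))
    hcond
  have hlt' : H₁ * H₂ / (H₁ + H₂) * (2 * ∑ i, ((k i : ℝ) + δ) + d) < 1 := by
    refine lt_of_eq_of_lt ?_ hlt
    rw [Finset.sum_add_distrib, Finset.sum_const, Finset.card_univ, Fintype.card_fin, nsmul_eq_mul]
    ring
  obtain ⟨n, hn⟩ := exists_nat_gt (max (m : ℝ) (d / δ))
  have hmn : m ≤ n := by exact_mod_cast ((le_max_left _ _).trans_lt hn).le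
  have hdn : (d : ℝ) < δ * n := by
    have := (le_max_right (m : ℝ) (d / δ)).trans_lt hn
    rwa [div_lt_iff₀' hδ] at this
  have hC := lintegral_momentKernel_incrementDiff_lt_top hH₁.1 hH₂.1 hXmeas hXtmeas hGauss
    hVarSplit hVarCoordX hVarCoordXt hLNDX hLNDXt hT (M := 2 * n) (by omega)
    (κ := fun i => k i + δ) (fun i => by positivity) hlt'
  set τ : Measure (ℝ × ℝ) :=
    (volume.restrict (Set.Icc 0 T)).prod (volume.restrict (Set.Icc 0 T)) with hτ
  have hX0 : Measurable (X 0) := hXmeas.comp (measurable_const.prodMk measurable_id)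
  have hXt0 : Measurable (Xt 0) := hXtmeas.comp (measurable_const.prodMk measurable_id)
  have hN : Measurable fun ω => X 0 ω - Xt 0 ω := hX0.sub hXt0
  have hNmom : ∫⁻ ω, ENNReal.ofReal (∏ i, (3 + 2 * (X 0 ω - Xt 0 ω) i ^ 2)) ∂P < ∞ := by
    refine lintegral_prod_three_add_two_mul_sq_lt_top hd hN fun i => ?_
    have h := hGauss 1 (fun _ => 0) (fun _ => 0) (fun _ => le_rfl) (fun _ => le_rfl)
      (fun _ => Pi.single i 1)
    simp only [Finset.univ_unique, Finset.sum_singleton, Pi.single_apply, ite_mul, one_mul,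
      zero_mul, Finset.sum_ite_eq', Finset.mem_univ, if_true] at h
    exact ⟨_, h⟩
  obtain ⟨C, hC', hbound⟩ := exists_lintegral_comp_random_point_le hN hNmom (m := n) (by omega)
    hdn hC
  refine ⟨(1 + C).toReal, ENNReal.toReal_pos (by simp)
    (ENNReal.add_lt_top.2 ⟨ENNReal.one_lt_top, hC'⟩).ne, fun ε hε x => ?_⟩
  have hZ := measurable_incrementDiff hXmeas hXtmeas
  have hmeas : Measurable fun p : (Fin d → ℝ) × Ω =>
      shiftedOccupation k ε τ (incrementDiff X Xt) (p.1 - x) p.2 :=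
    (measurable_shiftedOccupation hε hZ).comp
      ((measurable_fst.sub_const x).prodMk measurable_snd)
  simp only [Real.rpow_natCast, locTimeApprox_eq_shiftedOccupation hXmeas hXtmeas k hε]
  refine integral_abs_pow_le_of_lintegral_enorm_pow_le (hmeas.comp (hN.prodMk measurable_id))
    hmn hC' (hbound (fun a ω => shiftedOccupation k ε τ (incrementDiff X Xt) (a - x) ω) hmeas
      (fun ω => (continuous_shiftedOccupation hε hZ ω).comp (continuous_sub_right x))
      (fun a => lintegral_shiftedOccupation_le hε hZ hδ (even_two_mul n) (a - x)) fun a b => ?_)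
  simpa using lintegral_shiftedOccupation_sub_le hε hZ hδ hδ1 (even_two_mul n) (a - x) (b - x)
    (P := P) (k := k) (τ := τ)

end
end

section
/- Let d≥1 be an integer, |k|≥0 an integer, T>0, and H₁,H₂∈(0,1); write ρ = H₁H₂/(H₁+H₂). Set G(ε) = ∫_{[0,T]⁴} (t₂^{2H₂}+s₂^{2H₁}+ε)^{−d/2} · (t₁^{2H₂}+s₁^{2H₁}+ε)^{−d/2−|k|} dt₁ dt₂ ds₁ ds₂. Then there exists c>0 such that for all ε∈(0,T/2): (i) if ρd>1 and |k|=0, then G(ε) ≥ c·ε^{1/ρ − d}; (ii) if ρd=1 and |k|=0, then G(ε) ≥ c·(ln(1+ε^{−1/2}))²; (iii) if ρd=1 and ρ(2|k|+d)>1, then G(ε) ≥ c·ln(1+ε^{−1/2})·ε^{1/(2ρ) − d/2 − |k|}; (iv) if ρd<1 and ρ(2|k|+d)>1, then G(ε) ≥ c·ε^{1/(2ρ) − d/2 − |k|}; (v) if ρd<1 and ρ(2|k|+d)=1, then G(ε) ≥ c·ln(1+ε^{−1/2}). -/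
open MeasureTheory

noncomputable section

/-- The two-variable integral `∫∫_{[0,T]²} (|t| ^ a + |s| ^ b + ε) ^ (-p)`. -/
def planarIntegral (T a b p ε : ℝ) : ℝ :=
  ∫ t in (0 : ℝ)..T, ∫ s in (0 : ℝ)..T, (|t| ^ a + |s| ^ b + ε) ^ (-p)

lemma mul_le_intervalIntegral_of_le {f : ℝ → ℝ} (hf : Continuous f) (hf0 : ∀ x, 0 ≤ f x)
    {δ T m : ℝ} (hδ : 0 ≤ δ) (hδT : δ ≤ T) (hm : ∀ x ∈ Set.Icc 0 δ, m ≤ f x) :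
    δ * m ≤ ∫ x in (0 : ℝ)..T, f x := by
  have h1 : ∫ _ in (0 : ℝ)..δ, m ≤ ∫ x in (0 : ℝ)..δ, f x :=
    intervalIntegral.integral_mono_on hδ (by simp) (hf.intervalIntegrable _ _) hm
  have h2 : ∫ x in (0 : ℝ)..δ, f x ≤ ∫ x in (0 : ℝ)..T, f x :=
    intervalIntegral.integral_mono_interval le_rfl hδ hδT
      (Filter.Eventually.of_forall hf0) (hf.intervalIntegrable _ _)
  simp only [intervalIntegral.integral_const, sub_zero, smul_eq_mul] at h1
  exact h1.trans h2

lemma add_abs_rpow_pos {a b ε : ℝ} (hε : 0 < ε) (t s : ℝ) : 0 < |t| ^ a + |s| ^ b + ε := by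
  positivity

lemma continuous_integrand {a b ε : ℝ} (ha : 0 < a) (hb : 0 < b) (hε : 0 < ε) (p : ℝ) :
    Continuous (Function.uncurry fun t s : ℝ => (|t| ^ a + |s| ^ b + ε) ^ (-p)) := by
  refine Continuous.rpow_const ?_ fun x => Or.inl (add_abs_rpow_pos hε x.1 x.2).ne'
  exact ((continuous_fst.abs.rpow_const fun _ => Or.inr ha.le).add
    (continuous_snd.abs.rpow_const fun _ => Or.inr hb.le)).add continuous_const

lemma continuous_integrand_right {a b ε : ℝ} (ha : 0 < a) (hb : 0 < b) (hε : 0 < ε) (p t : ℝ) :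
    Continuous fun s : ℝ => (|t| ^ a + |s| ^ b + ε) ^ (-p) :=
  (continuous_integrand ha hb hε p).comp (Continuous.prodMk_right t)

lemma continuous_integral_inner {a b ε : ℝ} (ha : 0 < a) (hb : 0 < b) (hε : 0 < ε) (p T : ℝ) :
    Continuous fun t : ℝ => ∫ s in (0 : ℝ)..T, (|t| ^ a + |s| ^ b + ε) ^ (-p) :=
  intervalIntegral.continuous_parametric_intervalIntegral_of_continuous'
    (continuous_integrand ha hb hε p) 0 T

lemma integral_inner_nonneg {a b ε T : ℝ} (hT : 0 < T) (hε : 0 < ε) (p t : ℝ) :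
    0 ≤ ∫ s in (0 : ℝ)..T, (|t| ^ a + |s| ^ b + ε) ^ (-p) :=
  intervalIntegral.integral_nonneg hT.le fun s _ =>
    (Real.rpow_pos_of_pos (add_abs_rpow_pos hε t s) _).le

lemma mul_le_planarIntegral {T a b p ε δ₁ δ₂ M : ℝ} (hT : 0 < T) (ha : 0 < a) (hb : 0 < b)
    (hp : 0 ≤ p) (hε : 0 < ε) (h₁ : 0 ≤ δ₁) (h₁T : δ₁ ≤ T) (h₂ : 0 ≤ δ₂) (h₂T : δ₂ ≤ T)
    (hM : δ₁ ^ a + δ₂ ^ b + ε ≤ M) :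
    δ₁ * (δ₂ * M ^ (-p)) ≤ planarIntegral T a b p ε := by
  refine mul_le_intervalIntegral_of_le (continuous_integral_inner ha hb hε p T)
    (integral_inner_nonneg hT hε p) h₁ h₁T fun t ht => ?_
  refine mul_le_intervalIntegral_of_le (continuous_integrand_right ha hb hε p t)
    (fun s => (Real.rpow_pos_of_pos (add_abs_rpow_pos hε t s) _).le) h₂ h₂T fun s hs => ?_
  refine Real.rpow_le_rpow_of_nonpos (add_abs_rpow_pos hε t s) (le_trans ?_ hM) (by linarith)
  have e1 := Real.rpow_le_rpow (abs_nonneg t) ((abs_of_nonneg ht.1).trans_le ht.2) ha.le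
  have e2 := Real.rpow_le_rpow (abs_nonneg s) ((abs_of_nonneg hs.1).trans_le hs.2) hb.le
  linarith

lemma exists_const_le_planarIntegral {T a b p : ℝ} (hT : 0 < T) (ha : 0 < a) (hb : 0 < b)
    (hp : 0 ≤ p) :
    ∃ c : ℝ, 0 < c ∧ ∀ ε ∈ Set.Ioo (0 : ℝ) (T / 2), c ≤ planarIntegral T a b p ε := by
  refine ⟨T * (T * (T ^ a + T ^ b + T) ^ (-p)), by positivity, fun ε hε => ?_⟩
  exact mul_le_planarIntegral hT ha hb hp hε.1 hT.le le_rfl hT.le le_rfl (by linarith [hε.2])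

/-- A fixed multiple of `w ^ (1 / b)` stays below `T` as long as `w ≤ W`. -/
lemma exists_mul_rpow_le {T W b : ℝ} (hT : 0 < T) (hW : 0 < W) (hb : 0 < b) :
    ∃ η : ℝ, 0 < η ∧ ∀ w : ℝ, 0 < w → w ≤ W →
      η * w ^ (1 / b) ≤ T ∧ (η * w ^ (1 / b)) ^ b ≤ w := by
  have hWb : 0 < W ^ (1 / b) := Real.rpow_pos_of_pos hW _
  have hη : 0 < min 1 (T / W ^ (1 / b)) := lt_min one_pos (div_pos hT hWb)
  refine ⟨_, hη, fun w hw hwW => ⟨?_, ?_⟩⟩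
  · calc min 1 (T / W ^ (1 / b)) * w ^ (1 / b) ≤ T / W ^ (1 / b) * W ^ (1 / b) := by
          gcongr
          exact min_le_right _ _
      _ = T := div_mul_cancel₀ _ hWb.ne'
  · calc (min 1 (T / W ^ (1 / b)) * w ^ (1 / b)) ^ b ≤ (1 * w ^ (1 / b)) ^ b := by
          gcongr
          exact min_le_left _ _
      _ = w := by
          rw [one_mul, ← Real.rpow_mul hw.le, one_div_mul_cancel hb.ne', Real.rpow_one]

lemma exists_rpow_le_planarIntegral {T a b p : ℝ} (hT : 0 < T) (ha : 0 < a) (hb : 0 < b)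
    (hp : 0 ≤ p) :
    ∃ c : ℝ, 0 < c ∧ ∀ ε ∈ Set.Ioo (0 : ℝ) (T / 2),
      c * ε ^ (1 / a + 1 / b - p) ≤ planarIntegral T a b p ε := by
  obtain ⟨η₁, h₁, H₁⟩ := exists_mul_rpow_le hT (half_pos hT) ha
  obtain ⟨η₂, h₂, H₂⟩ := exists_mul_rpow_le hT (half_pos hT) hb
  refine ⟨η₁ * η₂ * 3 ^ (-p), by positivity, fun ε hε => ?_⟩
  have hε0 : 0 < ε := hε.1
  obtain ⟨k₁, l₁⟩ := H₁ ε hε.1 hε.2.le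
  obtain ⟨k₂, l₂⟩ := H₂ ε hε.1 hε.2.le
  refine le_of_eq_of_le ?_ (mul_le_planarIntegral (M := 3 * ε) hT ha hb hp hε.1
    (by positivity) k₁ (by positivity) k₂ (by linarith))
  rw [Real.mul_rpow (by norm_num) hε.1.le, sub_eq_add_neg, Real.rpow_add hε.1,
    Real.rpow_add hε.1]
  ring

lemma exists_rpow_le_integral_inner {T a b p : ℝ} (hT : 0 < T) (ha : 0 < a) (hb : 0 < b)
    (hp : 0 ≤ p) :
    ∃ c : ℝ, 0 < c ∧ ∀ ε ∈ Set.Ioo (0 : ℝ) (T / 2), ∀ t ∈ Set.Icc 0 T,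
      c * (t ^ a + ε) ^ (1 / b - p) ≤ ∫ s in (0 : ℝ)..T, (|t| ^ a + |s| ^ b + ε) ^ (-p) := by
  obtain ⟨η, h, H⟩ := exists_mul_rpow_le hT (W := T ^ a + T) (by positivity) hb
  refine ⟨η * 2 ^ (-p), by positivity, fun ε hε t ht => ?_⟩
  have hw : 0 < t ^ a + ε := add_pos_of_nonneg_of_pos (Real.rpow_nonneg ht.1 _) hε.1
  have hta : t ^ a ≤ T ^ a := Real.rpow_le_rpow ht.1 ht.2 ha.le
  obtain ⟨k, l⟩ := H _ hw (by linarith [hε.2])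
  have hδ : 0 ≤ η * (t ^ a + ε) ^ (1 / b) := by positivity
  refine le_of_eq_of_le ?_ (mul_le_intervalIntegral_of_le (m := (2 * (t ^ a + ε)) ^ (-p))
    (continuous_integrand_right ha hb hε.1 p t)
    (fun s => (Real.rpow_pos_of_pos (add_abs_rpow_pos hε.1 t s) _).le) hδ k fun s hs => ?_)
  · rw [Real.mul_rpow (by norm_num) hw.le, sub_eq_add_neg, Real.rpow_add hw]
    ring
  · refine Real.rpow_le_rpow_of_nonpos (add_abs_rpow_pos hε.1 t s) ?_ (by linarith)
    have e := Real.rpow_le_rpow (abs_nonneg s) ((abs_of_nonneg hs.1).trans_le hs.2) hb.le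
    rw [abs_of_nonneg ht.1]
    linarith

lemma inv_add_rpow_le {a ε t : ℝ} (ha : 0 < a) (hε : 0 < ε) (ht : 0 ≤ t) :
    2 ^ (-(1 / a)) * (t + ε ^ (1 / a))⁻¹ ≤ (t ^ a + ε) ^ (-(1 / a)) := by
  have hr : 0 < ε ^ (1 / a) := Real.rpow_pos_of_pos hε _
  have hu : 0 < t + ε ^ (1 / a) := by positivity
  have e1 : t ^ a ≤ (t + ε ^ (1 / a)) ^ a := Real.rpow_le_rpow ht (by linarith) ha.le
  have e2 : ε ≤ (t + ε ^ (1 / a)) ^ a := by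
    calc ε = (ε ^ (1 / a)) ^ a := by
          rw [← Real.rpow_mul hε.le, one_div_mul_cancel ha.ne', Real.rpow_one]
      _ ≤ _ := Real.rpow_le_rpow hr.le (by linarith) ha.le
  calc 2 ^ (-(1 / a)) * (t + ε ^ (1 / a))⁻¹ = (2 * (t + ε ^ (1 / a)) ^ a) ^ (-(1 / a)) := by
        rw [Real.mul_rpow (by norm_num) (by positivity), ← Real.rpow_mul hu.le,
          mul_neg, mul_one_div_cancel ha.ne', Real.rpow_neg_one]
    _ ≤ _ := Real.rpow_le_rpow_of_nonpos (by positivity) (by linarith)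
        (neg_nonpos.2 (by positivity))

lemma integral_inv_add {T r : ℝ} (hT : 0 < T) (hr : 0 < r) :
    ∫ t in (0 : ℝ)..T, (t + r)⁻¹ = Real.log (1 + T / r) := by
  rw [intervalIntegral.integral_comp_add_right (fun x => x⁻¹) r,
    integral_inv_of_pos (by linarith) (by linarith)]
  congr 1
  field_simp
  ring

lemma mul_log_one_add_le {m x : ℝ} (hm0 : 0 < m) (hm1 : m ≤ 1) (hx : 0 ≤ x) :
    m * Real.log (1 + x) ≤ Real.log (1 + m * x) := by
  rw [← Real.log_rpow (by linarith)]
  exact Real.log_le_log (by positivity)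
    (rpow_one_add_le_one_add_mul_self (by linarith) hm0.le hm1)

lemma exists_mul_log_le {T a : ℝ} (hT : 0 < T) (ha : 0 < a) (ha2 : a ≤ 2) :
    ∃ m : ℝ, 0 < m ∧ ∀ ε ∈ Set.Ioo (0 : ℝ) (T / 2),
      m * Real.log (1 + ε ^ (-(1 : ℝ) / 2)) ≤ Real.log (1 + T / ε ^ (1 / a)) := by
  have hpos : 0 < T * (T / 2) ^ (1 / 2 - 1 / a) := by positivity
  have hm : 0 < min 1 (T * (T / 2) ^ (1 / 2 - 1 / a)) := lt_min one_pos hpos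
  refine ⟨_, hm, fun ε hε => ?_⟩
  have hε0 : 0 < ε := hε.1
  refine (mul_log_one_add_le hm (min_le_left _ _) (by positivity)).trans ?_
  refine Real.log_le_log (by positivity) (add_le_add le_rfl ?_)
  have hexp : 1 / 2 - 1 / a ≤ 0 := sub_nonpos.2 (one_div_le_one_div_of_le ha ha2)
  calc min 1 (T * (T / 2) ^ (1 / 2 - 1 / a)) * ε ^ (-(1 : ℝ) / 2)
      ≤ T * ε ^ (1 / 2 - 1 / a) * ε ^ (-(1 : ℝ) / 2) := by
        gcongr
        refine (min_le_right _ _).trans ?_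
        exact mul_le_mul_of_nonneg_left
          (Real.rpow_le_rpow_of_nonpos hε.1 hε.2.le hexp) hT.le
    _ = T / ε ^ (1 / a) := by
        rw [mul_assoc, ← Real.rpow_add hε.1, div_eq_mul_inv T, ← Real.rpow_neg hε.1.le]
        congr 2
        ring

lemma exists_log_le_planarIntegral {T a b : ℝ} (hT : 0 < T) (ha : 0 < a) (ha2 : a ≤ 2)
    (hb : 0 < b) :
    ∃ c : ℝ, 0 < c ∧ ∀ ε ∈ Set.Ioo (0 : ℝ) (T / 2),
      c * Real.log (1 + ε ^ (-(1 : ℝ) / 2)) ≤ planarIntegral T a b (1 / a + 1 / b) ε := by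
  obtain ⟨c, hc, H⟩ := exists_rpow_le_integral_inner (p := 1 / a + 1 / b) hT ha hb (by positivity)
  obtain ⟨m, hm, L⟩ := exists_mul_log_le hT ha ha2
  refine ⟨c * 2 ^ (-(1 / a)) * m, by positivity, fun ε hε => ?_⟩
  have hr : 0 < ε ^ (1 / a) := Real.rpow_pos_of_pos hε.1 _
  have hexp : 1 / b - (1 / a + 1 / b) = -(1 / a) := by ring
  have hint : IntervalIntegrable
      (fun t => c * 2 ^ (-(1 / a)) * (t + ε ^ (1 / a))⁻¹) volume 0 T := by
    refine ContinuousOn.intervalIntegrable ?_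
    refine continuousOn_const.mul ((continuousOn_id.add continuousOn_const).inv₀ fun t ht => ?_)
    rw [Set.uIcc_of_le hT.le] at ht
    exact (add_pos_of_nonneg_of_pos ht.1 hr).ne'
  calc c * 2 ^ (-(1 / a)) * m * Real.log (1 + ε ^ (-(1 : ℝ) / 2))
      = c * 2 ^ (-(1 / a)) * (m * Real.log (1 + ε ^ (-(1 : ℝ) / 2))) := by ring
    _ ≤ c * 2 ^ (-(1 / a)) * Real.log (1 + T / ε ^ (1 / a)) := by
        have := L ε hε
        gcongr
    _ = ∫ t in (0 : ℝ)..T, c * 2 ^ (-(1 / a)) * (t + ε ^ (1 / a))⁻¹ := by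
        rw [intervalIntegral.integral_const_mul, integral_inv_add hT hr]
    _ ≤ planarIntegral T a b (1 / a + 1 / b) ε := by
        refine intervalIntegral.integral_mono_on hT.le hint
          ((continuous_integral_inner ha hb hε.1 _ T).intervalIntegrable _ _) fun t ht => ?_
        refine le_trans ?_ (H ε hε t ht)
        rw [hexp, mul_assoc]
        have := inv_add_rpow_le ha hε.1 ht.1
        gcongr

lemma exists_bounds_planarIntegral {T a b p : ℝ} (hT : 0 < T) (ha : 0 < a) (ha2 : a ≤ 2)
    (hb : 0 < b) (hp : 0 ≤ p) :
    ∃ c : ℝ, 0 < c ∧ ∀ ε ∈ Set.Ioo (0 : ℝ) (T / 2),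
      c ≤ planarIntegral T a b p ε ∧
      c * ε ^ (1 / a + 1 / b - p) ≤ planarIntegral T a b p ε ∧
      (p = 1 / a + 1 / b →
        c * Real.log (1 + ε ^ (-(1 : ℝ) / 2)) ≤ planarIntegral T a b p ε) := by
  obtain ⟨c₁, h₁, H₁⟩ := exists_const_le_planarIntegral hT ha hb hp
  obtain ⟨c₂, h₂, H₂⟩ := exists_rpow_le_planarIntegral hT ha hb hp
  obtain ⟨c₃, h₃, H₃⟩ := exists_log_le_planarIntegral hT ha ha2 hb
  refine ⟨min c₁ (min c₂ c₃), by positivity, fun ε hε => ?_⟩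
  have hε0 : 0 < ε := hε.1
  have hlog : 0 ≤ Real.log (1 + ε ^ (-(1 : ℝ) / 2)) :=
    Real.log_nonneg (le_add_of_nonneg_right (by positivity))
  refine ⟨(min_le_left _ _).trans (H₁ ε hε), le_trans ?_ (H₂ ε hε), ?_⟩
  · gcongr
    exact (min_le_right _ _).trans (min_le_left _ _)
  · rintro rfl
    refine le_trans ?_ (H₃ ε hε)
    gcongr
    exact (min_le_right _ _).trans (min_le_right _ _)

lemma integral_eq_planarIntegral_mul {T : ℝ} (hT : 0 < T) (a b p q ε : ℝ) :
    (∫ t₁ in (0 : ℝ)..T, ∫ t₂ in (0 : ℝ)..T, ∫ s₁ in (0 : ℝ)..T, ∫ s₂ in (0 : ℝ)..T,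
      (t₂ ^ a + s₂ ^ b + ε) ^ (-p) * (t₁ ^ a + s₁ ^ b + ε) ^ (-q)) =
    planarIntegral T a b p ε * planarIntegral T a b q ε := by
  have key (r : ℝ) : (∫ t in (0 : ℝ)..T, ∫ s in (0 : ℝ)..T, (t ^ a + s ^ b + ε) ^ (-r)) =
      planarIntegral T a b r ε := by
    refine intervalIntegral.integral_congr fun t ht => intervalIntegral.integral_congr
      fun s hs => ?_
    rw [Set.uIcc_of_le hT.le] at ht hs
    simp only [abs_of_nonneg ht.1, abs_of_nonneg hs.1]
  simp only [intervalIntegral.integral_mul_const, intervalIntegral.integral_const_mul, key]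

theorem stmt17
    (d : ℕ) (hd : 1 ≤ d) (K : ℕ) (T : ℝ) (hT : 0 < T)
    (H₁ H₂ : ℝ) (hH₁ : H₁ ∈ Set.Ioo (0 : ℝ) 1) (hH₂ : H₂ ∈ Set.Ioo (0 : ℝ) 1)
    (G : ℝ → ℝ)
    (hG : ∀ ε : ℝ, G ε =
      ∫ t₁ in (0 : ℝ)..T, ∫ t₂ in (0 : ℝ)..T, ∫ s₁ in (0 : ℝ)..T, ∫ s₂ in (0 : ℝ)..T,
        (t₂ ^ (2 * H₂) + s₂ ^ (2 * H₁) + ε) ^ (-(d : ℝ) / 2) *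
          (t₁ ^ (2 * H₂) + s₁ ^ (2 * H₁) + ε) ^ (-(d : ℝ) / 2 - K)) :
    ∃ c : ℝ, 0 < c ∧ ∀ ε ∈ Set.Ioo (0 : ℝ) (T / 2),
      ((1 < H₁ * H₂ / (H₁ + H₂) * d ∧ K = 0) →
        c * ε ^ ((H₁ + H₂) / (H₁ * H₂) - d) ≤ G ε) ∧
      ((H₁ * H₂ / (H₁ + H₂) * d = 1 ∧ K = 0) →
        c * (Real.log (1 + ε ^ (-(1 : ℝ) / 2))) ^ 2 ≤ G ε) ∧
      ((H₁ * H₂ / (H₁ + H₂) * d = 1 ∧ 1 < H₁ * H₂ / (H₁ + H₂) * (2 * K + d)) →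
        c * Real.log (1 + ε ^ (-(1 : ℝ) / 2)) *
            ε ^ ((H₁ + H₂) / (2 * H₁ * H₂) - d / 2 - K) ≤ G ε) ∧
      ((H₁ * H₂ / (H₁ + H₂) * d < 1 ∧ 1 < H₁ * H₂ / (H₁ + H₂) * (2 * K + d)) →
        c * ε ^ ((H₁ + H₂) / (2 * H₁ * H₂) - d / 2 - K) ≤ G ε) ∧
      ((H₁ * H₂ / (H₁ + H₂) * d < 1 ∧ H₁ * H₂ / (H₁ + H₂) * (2 * K + d) = 1) →
        c * Real.log (1 + ε ^ (-(1 : ℝ) / 2)) ≤ G ε) := by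
  obtain ⟨hH₁0, hH₁1⟩ := hH₁
  obtain ⟨hH₂0, hH₂1⟩ := hH₂
  obtain ⟨m, hm, M⟩ := exists_bounds_planarIntegral (T := T) (a := 2 * H₂) (b := 2 * H₁)
    (p := (d : ℝ) / 2) hT (by linarith) (by linarith) (by linarith) (by positivity)
  obtain ⟨n, hn, N⟩ := exists_bounds_planarIntegral (T := T) (a := 2 * H₂) (b := 2 * H₁)
    (p := (d : ℝ) / 2 + K) hT (by linarith) (by linarith) (by linarith) (by positivity)
  refine ⟨m * n, mul_pos hm hn, fun ε hε => ?_⟩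
  have hε0 : 0 < ε := hε.1
  have hfac : G ε = planarIntegral T (2 * H₂) (2 * H₁) ((d : ℝ) / 2) ε *
      planarIntegral T (2 * H₂) (2 * H₁) ((d : ℝ) / 2 + K) ε := by
    rw [hG, ← integral_eq_planarIntegral_mul hT, ← neg_div, neg_add', ← neg_div]
  obtain ⟨m₁, m₂, m₃⟩ := M ε hε
  obtain ⟨n₁, n₂, n₃⟩ := N ε hε
  have hlog : 0 ≤ Real.log (1 + ε ^ (-(1 : ℝ) / 2)) :=
    Real.log_nonneg (le_add_of_nonneg_right (by positivity))
  have hq : 1 / (2 * H₂) + 1 / (2 * H₁) = (H₁ + H₂) / (2 * H₁ * H₂) := by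
    field_simp
  have hcrit (x : ℝ) (hx : H₁ * H₂ / (H₁ + H₂) * (2 * x) = 1) :
      x = 1 / (2 * H₂) + 1 / (2 * H₁) := by
    have : H₁ + H₂ ≠ 0 := by positivity
    rw [hq]
    field_simp at hx ⊢
    linarith
  have mul_le {x y : ℝ} (hx : 0 ≤ x) (hy : 0 ≤ y)
      (h₁ : m * x ≤ planarIntegral T (2 * H₂) (2 * H₁) ((d : ℝ) / 2) ε)
      (h₂ : n * y ≤ planarIntegral T (2 * H₂) (2 * H₁) ((d : ℝ) / 2 + K) ε) :
      m * n * (x * y) ≤ G ε := by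
    rw [hfac, mul_mul_mul_comm]
    exact mul_le_mul h₁ h₂ (by positivity) ((by positivity : 0 ≤ m * x).trans h₁)
  rw [hq] at m₂ n₂
  rw [← sub_sub] at n₂
  refine ⟨?_, ?_, ?_, ?_, ?_⟩
  · rintro ⟨-, rfl⟩
    convert mul_le (by positivity) (by positivity) m₂ n₂ using 2
    rw [← Real.rpow_add hε0]
    congr 1
    push_cast
    field_simp
    ring
  · rintro ⟨h, rfl⟩
    rw [sq]
    exact mul_le hlog hlog (m₃ (hcrit _ (by rw [← h]; ring)))
      (n₃ (hcrit _ (by rw [← h]; push_cast; ring)))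
  · rintro ⟨h, -⟩
    rw [mul_assoc (m * n)]
    exact mul_le hlog (by positivity) (m₃ (hcrit _ (by rw [← h]; ring))) n₂
  · rintro -
    simpa using mul_le zero_le_one (by positivity) (by simpa using m₁) n₂
  · rintro ⟨-, h⟩
    simpa using mul_le zero_le_one hlog (by simpa using m₁) (n₃ (hcrit _ (by rw [← h]; ring)))

end
end
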